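/- arXiv:2309.11237 — 6 statements merged into one kernel-verified Lean document; each statement's English description precedes it below -/
import Mathlib

section
/- Let k ≥ 3 be odd and let j ∈ {1, k+2} ∪ {4, 5, …, k−1}. Then for all x ∈ 𝒢_1 and z ∈ 𝒢_j, D_{1,j}(x,z) ≤ (k−1)π/k. -/
open Real

noncomputable section

/-- Euclidean space ℝ^d. -/
abbrev Euc (d : ℕ) : Type := EuclideanSpace ℝ (Fin d)

/-- The unit sphere S^n = {x ∈ ℝ^{n+1} : ⟨x,x⟩ = 1}. -/
def usphere (n : ℕ) : Set (Euc (n+1)) := {x | @inner ℝ _ _ x x = (1:ℝ)}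

/-- The geodesic distance d(x,y) = arccos⟨x,y⟩. -/
def geoDist {d : ℕ} (x y : Euc d) : ℝ := Real.arccos (@inner ℝ _ _ x y)

/-- The circle distance between two angles θ, φ ∈ ℝ: the representative of
|θ − φ| modulo 2π lying in [0, π] (the geodesic distance in S¹ between
(cos θ, sin θ) and (cos φ, sin φ)). -/
def circleDist (θ φ : ℝ) : ℝ := Real.arccos (Real.cos (θ - φ))

/-- The coordinate index (0-based) of the cell 𝒢_m: the 1-based index m reduced
modulo k+1 to {1,…,k+1}, shifted to 0-based. -/
def gIdx (k m : ℕ) : Fin (k+1) := ⟨(m - 1) % (k + 1), Nat.mod_lt _ (Nat.succ_pos k)⟩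

/-- The sign of the cell 𝒢_m: writing m − 1 = q(k+1) + r, the sign is (−1)^{r+q}.
For 1 ≤ m ≤ k+1 this is (−1)^{m+1}, and 𝒢_{m+k+1} = −𝒢_m. -/
def gSign (k m : ℕ) : ℝ := (-1) ^ ((m - 1) % (k + 1) + (m - 1) / (k + 1))

/-- The cell 𝒢_m = (−1)^{m+1} G_{m mod (k+1)} ⊆ S^k, where G_i is the Voronoi cell
of the standard basis vector e_i with respect to {±e₁,…,±e_{k+1}}:
x ∈ 𝒢_m iff x ∈ S^k and the signed coordinate gSign·x_{gIdx} dominates all |x_j|. -/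
def Gcal (k m : ℕ) : Set (Euc (k+1)) :=
  {x | x ∈ usphere k ∧ ∀ j, |x j| ≤ gSign k m * x (gIdx k m)}

/-- The function f_m : 𝒢_m → ℝ (an angle parametrizing S¹),
f_m(x) = (m−1)π/(k+1) + (π/(2k(k+1)))·(x_1 + ⋯ + x_{m−1} − x_{m+1} − ⋯ − x_{k+1})/x_m,
coordinate subscripts taken modulo k+1 (as angles, i.e. modulo 2π, for m > k+1). -/
def fFun (k m : ℕ) (x : Euc (k+1)) : ℝ :=
  ((m : ℝ) - 1) * π / ((k : ℝ) + 1) + π / (2 * (k : ℝ) * ((k : ℝ) + 1)) *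
    ((∑ j : Fin (k+1),
        (if (j : ℕ) < (m - 1) % (k + 1) then (1:ℝ)
         else if (j : ℕ) = (m - 1) % (k + 1) then 0 else -1) * x j) / x (gIdx k m))

/-- Every coordinate of a point of a cell is dominated by the distinguished coordinate. -/
lemma abs_coord_le_of_mem_Gcal {k m : ℕ} {x : Euc (k+1)} (hx : x ∈ Gcal k m) (i : Fin (k+1)) :
    |x i| ≤ |x (gIdx k m)| := by
  refine (hx.2 i).trans ((le_abs_self _).trans ?_)
  rw [abs_mul]
  simp [gSign]

/-- On the cell `𝒢_m` the angle `f_m` stays within `π / (2(k+1))` of its central value. -/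
lemma abs_fFun_sub_center_le {k m : ℕ} (hk : 0 < k) {x : Euc (k+1)} (hx : x ∈ Gcal k m) :
    |fFun k m x - ((m : ℝ) - 1) * π / ((k : ℝ) + 1)| ≤ π / (2 * ((k : ℝ) + 1)) := by
  have hk' : (0 : ℝ) < k := by exact_mod_cast hk
  set S : ℝ := ∑ j : Fin (k+1),
    (if (j : ℕ) < (m - 1) % (k + 1) then (1:ℝ)
      else if (j : ℕ) = (m - 1) % (k + 1) then 0 else -1) * x j with hS
  have hsum : |S| ≤ k * |x (gIdx k m)| := by
    calc |S| ≤ ∑ j : Fin (k+1), (if j = gIdx k m then 0 else |x (gIdx k m)|) := by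
          refine (Finset.abs_sum_le_sum_abs _ _).trans (Finset.sum_le_sum fun j _ => ?_)
          have hj := abs_coord_le_of_mem_Gcal hx j
          rw [abs_mul]
          by_cases h : j = gIdx k m
          · have h' : (j : ℕ) = (m - 1) % (k + 1) := congrArg Fin.val h
            simp [h, gIdx]
          · have h' : (j : ℕ) ≠ (m - 1) % (k + 1) := fun h' => h (Fin.ext h')
            rw [if_neg h, if_neg h']
            split_ifs <;> simpa using hj
      _ = k * |x (gIdx k m)| := by
          rw [Finset.sum_ite, Finset.sum_const_zero, zero_add, Finset.sum_const,
            Finset.filter_ne', Finset.card_erase_of_mem (Finset.mem_univ _)]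
          simp
  have hratio : |S / x (gIdx k m)| ≤ k := by
    rw [abs_div]
    exact div_le_of_le_mul₀ (abs_nonneg _) hk'.le hsum
  have hf : fFun k m x - ((m : ℝ) - 1) * π / ((k : ℝ) + 1)
      = π / (2 * (k : ℝ) * ((k : ℝ) + 1)) * (S / x (gIdx k m)) := by
    rw [hS, fFun]
    ring
  have hc : 0 ≤ π / (2 * (k : ℝ) * ((k : ℝ) + 1)) := by positivity
  rw [hf, abs_mul, abs_of_nonneg hc]
  calc _ ≤ π / (2 * (k : ℝ) * ((k : ℝ) + 1)) * k := mul_le_mul_of_nonneg_left hratio hc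
    _ = π / (2 * ((k : ℝ) + 1)) := by field_simp

/-- The circle distance never exceeds the absolute difference of the angles. -/
lemma circleDist_le_abs_sub (θ φ : ℝ) : circleDist θ φ ≤ |θ - φ| := by
  rw [circleDist, ← Real.cos_abs]
  rcases le_total |θ - φ| π with h | h
  · rw [Real.arccos_cos (abs_nonneg _) h]
  · exact (Real.arccos_le_pi _).trans h

lemma sum_sq_eq_one_of_mem_usphere {n : ℕ} {x : Euc (n+1)} (hx : x ∈ usphere n) :
    ∑ i, x i ^ 2 = 1 := by
  have h : (∑ i, x i * x i : ℝ) = 1 := by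
    have hx' : @inner ℝ _ _ x x = (1 : ℝ) := hx
    rw [PiLp.inner_apply] at hx'
    simpa only [RCLike.inner_apply, conj_trivial] using hx'
  simpa only [sq] using h

lemma one_le_mul_sq_of_mem_Gcal_one {k : ℕ} {x : Euc (k+1)} (hx : x ∈ Gcal k 1) :
    1 ≤ ((k : ℝ) + 1) * x 0 ^ 2 := by
  have h0 : gIdx k 1 = 0 := by simp [gIdx]
  calc (1 : ℝ) = ∑ i, x i ^ 2 := (sum_sq_eq_one_of_mem_usphere hx.1).symm
    _ ≤ ∑ _i : Fin (k+1), x 0 ^ 2 := Finset.sum_le_sum fun i _ => by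
        simpa [h0] using sq_le_sq.2 (abs_coord_le_of_mem_Gcal hx i)
    _ = ((k : ℝ) + 1) * x 0 ^ 2 := by simp

/-- Two points of the cell `𝒢_1` stay away from being antipodal. -/
lemma le_inner_of_mem_Gcal_one {k : ℕ} {x z : Euc (k+1)} (hx : x ∈ Gcal k 1)
    (hz : z ∈ Gcal k 1) : -(1 - 2 / ((k : ℝ) + 1)) ≤ @inner ℝ _ _ x z := by
  have hk : (0 : ℝ) < (k : ℝ) + 1 := by positivity
  have pos : ∀ {y : Euc (k+1)}, y ∈ Gcal k 1 → 0 ≤ y 0 := fun {y} hy => by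
    have := (abs_nonneg _).trans (hy.2 0)
    simpa [gSign, gIdx] using this
  have hx0 := pos hx
  have hz0 := pos hz
  have hx1 : 1 / ((k : ℝ) + 1) ≤ x 0 ^ 2 := by
    rw [div_le_iff₀' hk]
    exact one_le_mul_sq_of_mem_Gcal_one hx
  have hz1 : 1 / ((k : ℝ) + 1) ≤ z 0 ^ 2 := by
    rw [div_le_iff₀' hk]
    exact one_le_mul_sq_of_mem_Gcal_one hz
  have hxz : 1 / ((k : ℝ) + 1) ≤ x 0 * z 0 := by
    refine le_of_sq_le_sq ?_ (mul_nonneg hx0 hz0)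
    rw [mul_pow, sq (1 / ((k : ℝ) + 1))]
    exact mul_le_mul hx1 hz1 (by positivity) (by positivity)
  have hinner : (@inner ℝ _ _ x z : ℝ) = x 0 * z 0 + ∑ i : Fin k, x i.succ * z i.succ := by
    rw [PiLp.inner_apply, Fin.sum_univ_succ]
    simp [mul_comm]
  have hxs := sum_sq_eq_one_of_mem_usphere hx.1
  have hzs := sum_sq_eq_one_of_mem_usphere hz.1
  rw [Fin.sum_univ_succ] at hxs hzs
  have htail : -((∑ i : Fin k, x i.succ ^ 2) + ∑ i : Fin k, z i.succ ^ 2)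
      ≤ 2 * ∑ i : Fin k, x i.succ * z i.succ := by
    rw [← Finset.sum_add_distrib, ← Finset.sum_neg_distrib, Finset.mul_sum]
    exact Finset.sum_le_sum fun i _ => by nlinarith [sq_nonneg (x i.succ + z i.succ)]
  have h2 : 2 / ((k : ℝ) + 1) = 2 * (1 / ((k : ℝ) + 1)) := by ring
  rw [hinner, h2]
  linarith

lemma one_sub_two_div_le_cos_pi_div {k : ℕ} (hk : 3 ≤ k) :
    1 - 2 / ((k : ℝ) + 1) ≤ Real.cos (π / k) := by
  rcases hk.eq_or_lt with rfl | hk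
  · norm_num [Real.cos_pi_div_three]
  · have hk' : (4 : ℝ) ≤ k := by exact_mod_cast hk
    refine le_trans ?_ (Real.one_sub_sq_div_two_le_cos)
    have hpi : π ^ 2 ≤ 10 := by nlinarith [Real.pi_lt_d2, Real.pi_pos]
    have : (π / k) ^ 2 / 2 ≤ 2 / ((k : ℝ) + 1) := by
      rw [div_pow, div_div, div_le_div_iff₀ (by positivity) (by positivity)]
      nlinarith
    linarith

lemma geoDist_le_of_mem_Gcal_one {k : ℕ} (hk : 3 ≤ k) {x z : Euc (k+1)} (hx : x ∈ Gcal k 1)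
    (hz : z ∈ Gcal k 1) : geoDist x z ≤ ((k : ℝ) - 1) * π / k := by
  have hk' : (3 : ℝ) ≤ k := by exact_mod_cast hk
  have hkpi : π / k ≤ π := div_le_self Real.pi_pos.le (by linarith)
  have hkpi0 : 0 ≤ π / k := by positivity
  have heq : ((k : ℝ) - 1) * π / k = π - π / k := by field_simp
  rw [heq, geoDist, ← Real.arccos_cos (x := π - π / k) (by linarith) (by linarith)]
  refine Real.arccos_le_arccos ?_
  rw [Real.cos_pi_sub]
  linarith [le_inner_of_mem_Gcal_one hx hz, one_sub_two_div_le_cos_pi_div hk]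

/-- The distortion bound inside a single cell. -/
lemma distortion_same_cell_le {k : ℕ} (hk : 3 ≤ k) {x z : Euc (k+1)} (hx : x ∈ Gcal k 1)
    (hz : z ∈ Gcal k 1) :
    |circleDist (fFun k 1 x) (fFun k 1 z) - geoDist x z| ≤ ((k : ℝ) - 1) * π / k := by
  have hk' : (3 : ℝ) ≤ k := by exact_mod_cast hk
  have hfx := abs_fFun_sub_center_le (by omega) hx
  have hfz := abs_fFun_sub_center_le (by omega) hz
  have hhalf : π / (2 * ((k : ℝ) + 1)) = π / ((k : ℝ) + 1) / 2 := by field_simp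
  have hsmall : π / ((k : ℝ) + 1) ≤ ((k : ℝ) - 1) * π / k := by
    rw [div_le_div_iff₀ (by positivity) (by positivity)]
    nlinarith [Real.pi_pos, mul_pos Real.pi_pos (show (0 : ℝ) < k by linarith)]
  have hc : circleDist (fFun k 1 x) (fFun k 1 z) ≤ π / ((k : ℝ) + 1) := by
    refine (circleDist_le_abs_sub _ _).trans ?_
    rw [abs_le] at hfx hfz ⊢
    constructor <;> linarith
  have hc0 : 0 ≤ circleDist (fFun k 1 x) (fFun k 1 z) := Real.arccos_nonneg _
  have hg0 : 0 ≤ geoDist x z := Real.arccos_nonneg _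
  have hg := geoDist_le_of_mem_Gcal_one hk hx hz
  rw [abs_le]
  constructor <;> linarith

lemma neg_mem_Gcal_one {k : ℕ} {z : Euc (k+1)} (hz : z ∈ Gcal k (k + 2)) :
    -z ∈ Gcal k 1 := by
  refine ⟨?_, fun i => ?_⟩
  · simpa [usphere] using hz.1
  · simpa [gSign, gIdx] using hz.2 i

lemma fFun_antipodal (k : ℕ) (z : Euc (k+1)) :
    fFun k (k + 2) z = fFun k 1 (-z) + π := by
  have hk : (k : ℝ) + 1 ≠ 0 := by positivity
  have hs : ((k + 2 : ℕ) : ℝ) - 1 = (k : ℝ) + 1 := by push_cast; ring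
  have hpi : ((k : ℝ) + 1) * π / ((k : ℝ) + 1) = π := by field_simp
  simp only [fFun, hs, hpi]
  simp [gIdx, add_comm]

/-- The distortion bound for cells whose indices are at cyclic distance between `3` and `k - 2`. -/
lemma distortion_far_cells_le {k j : ℕ} (hj4 : 4 ≤ j) (hjk : j ≤ k - 1)
    {x z : Euc (k+1)} (hx : x ∈ Gcal k 1) (hz : z ∈ Gcal k j) :
    |circleDist (fFun k 1 x) (fFun k j z) - geoDist x z| ≤ ((k : ℝ) - 1) * π / k := by
  have hk' : (5 : ℝ) ≤ k := by exact_mod_cast (show 5 ≤ k by omega)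
  have hj4' : (4 : ℝ) ≤ j := by exact_mod_cast hj4
  have hjk' : (j : ℝ) + 1 ≤ k := by exact_mod_cast (show j + 1 ≤ k by omega)
  have hfx := abs_fFun_sub_center_le (by omega) hx
  have hfz := abs_fFun_sub_center_le (by omega) hz
  set u : ℝ := π / ((k : ℝ) + 1) with hu
  have hu0 : 0 < u := by positivity
  have hhalf : π / (2 * ((k : ℝ) + 1)) = u / 2 := by rw [hu]; field_simp
  have hpi : π = ((k : ℝ) + 1) * u := by rw [hu]; field_simp
  have hcj : ((j : ℝ) - 1) * π / ((k : ℝ) + 1) = ((j : ℝ) - 1) * u := by rw [hu]; ring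
  have hc1 : (((1 : ℕ) : ℝ) - 1) * π / ((k : ℝ) + 1) = 0 := by simp
  rw [hhalf, abs_le] at hfx hfz
  rw [hc1] at hfx
  rw [hcj] at hfz
  have hlow : 2 * u ≤ fFun k j z - fFun k 1 x := by nlinarith
  have hupp : fFun k j z - fFun k 1 x ≤ ((k : ℝ) - 1) * u := by nlinarith
  have hcirc : circleDist (fFun k 1 x) (fFun k j z) = fFun k j z - fFun k 1 x := by
    rw [circleDist, ← Real.cos_neg, neg_sub, Real.arccos_cos (by linarith) (by nlinarith)]
  have hg0 : 0 ≤ geoDist x z := Real.arccos_nonneg _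
  have hgpi : geoDist x z ≤ π := Real.arccos_le_pi _
  have hb : ((k : ℝ) - 1) * π / k = π - π / k := by field_simp
  have hpk : π / k ≤ 2 * u := by
    rw [div_le_iff₀ (by linarith), hpi]
    nlinarith
  rw [hcirc, hb, abs_le]
  constructor <;> linarith

/-- Let k ≥ 3 be odd and j ∈ {1, k+2} ∪ {4, 5, …, k−1}. Then for all x ∈ 𝒢_1 and
z ∈ 𝒢_j, D_{1,j}(x,z) = |d_{S¹}(f_1(x), f_j(z)) − d_{S^k}(x,z)| ≤ (k−1)π/k. -/
theorem D1j_bound (k : ℕ) (hk : 3 ≤ k) (hodd : Odd k) (j : ℕ)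
    (hj : j = 1 ∨ j = k + 2 ∨ (4 ≤ j ∧ j ≤ k - 1))
    (x z : Euc (k+1)) (hx : x ∈ Gcal k 1) (hz : z ∈ Gcal k j) :
    |circleDist (fFun k 1 x) (fFun k j z) - geoDist x z| ≤ ((k : ℝ) - 1) * π / k := by
  rcases hj with rfl | rfl | ⟨hj4, hjk⟩
  · exact distortion_same_cell_le hk hx hz
  · have h := distortion_same_cell_le hk hx (neg_mem_Gcal_one hz)
    have hc : circleDist (fFun k 1 x) (fFun k (k + 2) z)
        = π - circleDist (fFun k 1 x) (fFun k 1 (-z)) := by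
      rw [circleDist, fFun_antipodal, ← sub_sub, Real.cos_sub_pi, Real.arccos_neg, circleDist]
    have hg : geoDist x z = π - geoDist x (-z) := by
      rw [geoDist, geoDist, inner_neg_right, Real.arccos_neg, sub_sub_cancel]
    rwa [hc, hg, sub_sub_sub_cancel_left, abs_sub_comm]
  · exact distortion_far_cells_le hj4 hjk hx hz
end
end

section
/- Let k ≥ 3 be odd. For all x ∈ 𝒢_1 and z ∈ 𝒢_k, (π/(2k(k+1)))·( (x_1 + ⋯ + x_{k+1})/x_1 + (z_1 + ⋯ + z_k − z_{k+1})/z_k − 2k ) ≤ ‖x − z‖, where ‖·‖ is the Euclidean norm on ℝ^{k+1}. -/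
open Real

noncomputable section

theorem sum_castSucc_le {k : ℕ} (x : Euc (k+1)) (a : ℝ) (h : ∀ j, |x j| ≤ a) :
    ∑ i, x i ≤ k * a + x (Fin.last k) := by
  rw [Fin.sum_univ_castSucc]
  have h1 : ∑ i : Fin k, x i.castSucc ≤ ∑ _i : Fin k, a :=
    Finset.sum_le_sum fun i _ => (abs_le.1 (h _)).2
  simp only [Finset.sum_const, Finset.card_univ, Fintype.card_fin, nsmul_eq_mul] at h1
  linarith

theorem one_le_mul_sq_of_mem_usphere {k : ℕ} {x : Euc (k+1)} (hx : x ∈ usphere k) (a : ℝ)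
    (h : ∀ j, |x j| ≤ a) : 1 ≤ ((k : ℝ) + 1) * a ^ 2 := by
  have h0 : ∑ i, x i ^ 2 = 1 := by
    rw [← EuclideanSpace.real_norm_sq_eq, ← real_inner_self_eq_norm_sq]
    exact hx
  have h1 : ∑ i, x i ^ 2 ≤ ∑ _i : Fin (k+1), a ^ 2 :=
    Finset.sum_le_sum fun i _ => sq_le_sq' (abs_le.1 (h i)).1 (abs_le.1 (h i)).2
  simp only [Finset.sum_const, Finset.card_univ, Fintype.card_fin, nsmul_eq_mul] at h1
  push_cast at h1
  linarith

theorem pos_of_mem_usphere {k : ℕ} {x : Euc (k+1)} (hx : x ∈ usphere k) (a : ℝ)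
    (h : ∀ j, |x j| ≤ a) : 0 < a := by
  have h1 := one_le_mul_sq_of_mem_usphere hx a h
  have h2 : 0 ≤ a := (abs_nonneg _).trans (h 0)
  rcases h2.eq_or_lt with h3 | h3
  · subst h3; norm_num at h1
  · exact h3

theorem pi_div_le_of_one_le {k : ℕ} (hk : 3 ≤ k) {a : ℝ} (ha : 0 < a)
    (h : 1 ≤ ((k : ℝ) + 1) * a ^ 2) : 2 * (π / (2 * (k : ℝ) * ((k : ℝ) + 1))) ≤ a := by
  have hk' : (3 : ℝ) ≤ k := by exact_mod_cast hk
  have e : 2 * (π / (2 * (k : ℝ) * ((k : ℝ) + 1))) = π / (k * (k + 1)) := by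
    field_simp
  rw [e, div_le_iff₀ (by positivity)]
  refine pi_le_four.trans (abs_le_of_sq_le_sq' ?_ (by positivity)).2
  have h1 : (36 : ℝ) ≤ (k : ℝ) ^ 2 * (k + 1) := by nlinarith
  calc (4 : ℝ) ^ 2 ≤ (k : ℝ) ^ 2 * (k + 1) * 1 := by linarith
    _ ≤ (k : ℝ) ^ 2 * (k + 1) * (((k : ℝ) + 1) * a ^ 2) := by gcongr
    _ = (a * (k * (k + 1))) ^ 2 := by ring

/-- Let k ≥ 3 be odd. For all x ∈ 𝒢_1 and z ∈ 𝒢_k,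
(π/(2k(k+1)))·((x_1+⋯+x_{k+1})/x_1 + (z_1+⋯+z_k−z_{k+1})/z_k − 2k) ≤ ‖x − z‖. -/
theorem case_j_eq_k (k : ℕ) (hk : 3 ≤ k) (hodd : Odd k)
    (x z : Euc (k+1)) (hx : x ∈ Gcal k 1) (hz : z ∈ Gcal k k) :
    π / (2 * (k : ℝ) * ((k : ℝ) + 1)) *
      ((∑ i, x i) / x ⟨0, Nat.succ_pos k⟩
        + ((∑ i, z i) - 2 * z ⟨k, Nat.lt_succ_self k⟩) / z ⟨k - 1, by omega⟩
        - 2 * (k : ℝ)) ≤ ‖x - z‖ := by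
  obtain ⟨hxs, hxa⟩ := hx
  obtain ⟨hzs, hza⟩ := hz
  have hIx : gIdx k 1 = ⟨0, Nat.succ_pos k⟩ := by simp [gIdx]
  have hIz : gIdx k k = ⟨k - 1, by omega⟩ := by
    simp only [gIdx, Fin.mk.injEq]
    exact Nat.mod_eq_of_lt (by omega)
  have hSx : gSign k 1 = 1 := by simp [gSign]
  have hSz : gSign k k = 1 := by
    rw [gSign, Nat.mod_eq_of_lt (by omega), Nat.div_eq_of_lt (by omega), add_zero]
    exact (Nat.Odd.sub_odd hodd odd_one).neg_one_pow
  rw [hSx, one_mul, hIx] at hxa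
  rw [hSz, one_mul, hIz] at hza
  have hcoord : ∀ i, |x i - z i| ≤ ‖x - z‖ := fun i => by
    simpa using PiLp.norm_apply_le (x - z) i
  have h1 := (abs_le.1 (hcoord ⟨0, Nat.succ_pos k⟩)).2
  have h2 := (abs_le.1 (hcoord ⟨k - 1, by omega⟩)).1
  have h3 := (abs_le.1 (hcoord (Fin.last k))).2
  have h4 := (abs_le.1 (hza ⟨0, Nat.succ_pos k⟩)).2
  have h5 := (abs_le.1 (hxa ⟨k - 1, by omega⟩)).2
  have hzN := hza (Fin.last k)
  have hsx := sum_castSucc_le x _ hxa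
  have hsz := sum_castSucc_le z _ hza
  have ha := pos_of_mem_usphere hxs _ hxa
  have hb := pos_of_mem_usphere hzs _ hza
  have hc := pi_div_le_of_one_le hk ha (one_le_mul_sq_of_mem_usphere hxs _ hxa)
  have hc0 : 0 ≤ π / (2 * (k : ℝ) * ((k : ℝ) + 1)) := by positivity
  have hlast : (⟨k, Nat.lt_succ_self k⟩ : Fin (k+1)) = Fin.last k := rfl
  rw [hlast]
  generalize π / (2 * (k : ℝ) * ((k : ℝ) + 1)) = c at hc hc0 ⊢
  generalize x ⟨0, Nat.succ_pos k⟩ = a at *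
  generalize z ⟨k - 1, by omega⟩ = b at *
  have hM := norm_nonneg (x - z)
  generalize ‖x - z‖ = M at *
  obtain ⟨u, hu⟩ : ∃ u, x (Fin.last k) = a * u := ⟨x (Fin.last k) / a, by field_simp⟩
  obtain ⟨v, hv⟩ : ∃ v, z (Fin.last k) = b * v := ⟨z (Fin.last k) / b, by field_simp⟩
  rw [hu, hv] at h3
  rw [hu] at hsx
  rw [hv] at hsz hzN ⊢
  have hv1 : |v| ≤ 1 := by
    rw [abs_mul, abs_of_pos hb] at hzN
    exact (mul_le_iff_le_one_right hb).1 hzN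
  have hX : (∑ i, x i) / a ≤ k + u := by
    rw [div_le_iff₀ ha]; linarith
  have hZ : ((∑ i, z i) - 2 * (b * v)) / b ≤ k - v := by
    rw [div_le_iff₀ hb]; linarith
  have hab : |b - a| ≤ M := abs_le.2 ⟨by linarith, by linarith⟩
  have hbv : (b - a) * v ≤ M :=
    calc (b - a) * v ≤ |b - a| * |v| := by rw [← abs_mul]; exact le_abs_self _
      _ ≤ M * 1 := by gcongr
      _ = M := mul_one M
  have hauv : a * (u - v) ≤ 2 * M := by linarith
  calc _ ≤ c * (u - v) := mul_le_mul_of_nonneg_left (by linarith) hc0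
    _ ≤ M := by
      rcases le_total (u - v) 0 with h | h
      · exact (mul_nonpos_of_nonneg_of_nonpos hc0 h).trans hM
      · linarith [mul_le_mul_of_nonneg_right hc h]
end
end

section
/- Let k ≥ 5 be odd. For all x ∈ 𝒢_1 and z ∈ 𝒢_{k+1}, (π/(2k(k+1)))·( (x_1 + ⋯ + x_{k+1})/x_1 + (z_1 + ⋯ + z_{k+1})/z_{k+1} ) ≤ ‖x − z‖, where ‖·‖ is the Euclidean norm on ℝ^{k+1}. -/
open Real

noncomputable section

/-- Cauchy–Schwarz bound of the coordinate sum by the Euclidean norm. -/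
lemma sum_coord_le_sqrt_mul_norm {d : ℕ} (y : Euc d) : ∑ i, y i ≤ √(d : ℝ) * ‖y‖ := by
  have h := sq_sum_le_card_mul_sum_sq (s := Finset.univ) (f := fun i => y i)
  rw [Finset.card_univ, Fintype.card_fin, ← EuclideanSpace.real_norm_sq_eq] at h
  refine (Real.le_sqrt_of_sq_le h).trans_eq ?_
  rw [Real.sqrt_mul (Nat.cast_nonneg d), Real.sqrt_sq (norm_nonneg y)]

/-- The largest coordinate of a unit vector is bounded below by `1 / √d`. -/
lemma one_le_sqrt_mul_of_abs_le {d : ℕ} {x : Euc d} {a : ℝ} (hx : ‖x‖ = 1) (ha : 0 ≤ a)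
    (h : ∀ j, |x j| ≤ a) : 1 ≤ √(d : ℝ) * a := by
  have h1 : ‖x‖ ^ 2 ≤ d * a ^ 2 := by
    rw [EuclideanSpace.real_norm_sq_eq]
    calc ∑ i, x i ^ 2 ≤ ∑ _i : Fin d, a ^ 2 :=
          Finset.sum_le_sum fun i _ => sq_le_sq' (abs_le.1 (h i)).1 (abs_le.1 (h i)).2
      _ = d * a ^ 2 := by simp
  have h2 : √(d : ℝ) * a = √(d * a ^ 2) := by
    rw [Real.sqrt_mul (Nat.cast_nonneg d), Real.sqrt_sq ha]
  rw [h2, Real.one_le_sqrt]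
  simpa [hx] using h1

/-- If `w q` dominates all coordinates of `w` in absolute value, then the coordinate sum is at
least `-(d - 2) * w q`. -/
lemma neg_sum_coord_le {d : ℕ} {w : Euc d} {q : Fin d} (h : ∀ j, |w j| ≤ w q) :
    -∑ i, w i ≤ ((d : ℝ) - 2) * w q := by
  have h1 : ∑ i ∈ Finset.univ.erase q, -w i ≤ ∑ _i ∈ Finset.univ.erase q, w q :=
    Finset.sum_le_sum fun i _ => (neg_le_abs _).trans (h i)
  have hd : 1 ≤ d := q.pos
  rw [Finset.sum_const, Finset.card_erase_of_mem (Finset.mem_univ q), Finset.card_univ,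
    Fintype.card_fin, nsmul_eq_mul, Nat.cast_sub hd, Finset.sum_neg_distrib] at h1
  have h2 := Finset.add_sum_erase Finset.univ (fun i => w i) (Finset.mem_univ q)
  push_cast at h1
  linarith

lemma sum_div_add_sum_div_le_of_le {d : ℕ} (hd : 2 ≤ d) {x w : Euc d} {p q : Fin d}
    (hx : ‖x‖ = 1) (hxp : ∀ j, |x j| ≤ x p) (hwq : ∀ j, |w j| ≤ w q) (hle : x p ≤ w q) :
    (∑ i, x i) / x p + (∑ i, w i) / w q ≤ (d + (d - 2) * √(d : ℝ)) * ‖x + w‖ := by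
  have ha0 : 0 ≤ x p := (abs_nonneg _).trans (hxp p)
  have h1 := one_le_sqrt_mul_of_abs_le hx ha0 hxp
  have ha : 0 < x p := by
    rcases ha0.eq_or_lt with h | h
    · rw [← h] at h1; norm_num at h1
    · exact h
  have hb : 0 < w q := ha.trans_le hle
  have hd' : (0 : ℝ) ≤ (d : ℝ) - 2 := by
    have : (2 : ℝ) ≤ d := by exact_mod_cast hd
    linarith
  have hss : √(d : ℝ) * √(d : ℝ) = d := Real.mul_self_sqrt (Nat.cast_nonneg d)
  have hinv : 1 / x p ≤ √(d : ℝ) := by rwa [div_le_iff₀ ha]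
  have hsum : (∑ i, x i) + ∑ i, w i ≤ √(d : ℝ) * ‖x + w‖ := by
    have := sum_coord_le_sqrt_mul_norm (x + w)
    simpa [Finset.sum_add_distrib] using this
  have hT : -((∑ i, w i) / w q) ≤ (d : ℝ) - 2 := by
    rw [← neg_div, div_le_iff₀ hb]
    exact neg_sum_coord_le hwq
  have hgap : w q - x p ≤ ‖x + w‖ := by
    have h2 := PiLp.norm_apply_le (x + w) q
    have h3 := (le_abs_self _).trans h2
    have h4 := (abs_le.1 (hxp q)).1
    simp only [PiLp.add_apply] at h3
    linarith
  have key : (∑ i, x i) / x p + (∑ i, w i) / w q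
      = ((∑ i, x i) + ∑ i, w i) * (1 / x p)
        + -((∑ i, w i) / w q) * ((w q - x p) * (1 / x p)) := by
    field_simp
    ring
  have e1 : ((∑ i, x i) + ∑ i, w i) * (1 / x p) ≤ d * ‖x + w‖ :=
    calc _ ≤ (√(d : ℝ) * ‖x + w‖) * (1 / x p) := by gcongr
      _ ≤ (√(d : ℝ) * ‖x + w‖) * √(d : ℝ) := by gcongr
      _ = d * ‖x + w‖ := by rw [mul_right_comm, hss]
  have hg0 : 0 ≤ w q - x p := sub_nonneg.2 hle
  have e2 : -((∑ i, w i) / w q) * ((w q - x p) * (1 / x p))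
      ≤ (d - 2) * (‖x + w‖ * √(d : ℝ)) := by
    gcongr
  rw [key]
  linarith

lemma sum_div_add_sum_div_le {d : ℕ} (hd : 2 ≤ d) {x w : Euc d} {p q : Fin d}
    (hx : ‖x‖ = 1) (hw : ‖w‖ = 1) (hxp : ∀ j, |x j| ≤ x p) (hwq : ∀ j, |w j| ≤ w q) :
    (∑ i, x i) / x p + (∑ i, w i) / w q ≤ (d + (d - 2) * √(d : ℝ)) * ‖x + w‖ := by
  rcases le_total (x p) (w q) with h | h
  · exact sum_div_add_sum_div_le_of_le hd hx hxp hwq h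
  · rw [add_comm, add_comm x w]
    exact sum_div_add_sum_div_le_of_le hd hw hwq hxp h

lemma norm_eq_one_of_mem_usphere {n : ℕ} {x : Euc (n + 1)} (h : x ∈ usphere n) : ‖x‖ = 1 := by
  have h1 : ‖x‖ ^ 2 = 1 := by rw [← real_inner_self_eq_norm_sq]; exact h
  exact (pow_eq_one_iff_of_nonneg (norm_nonneg x) two_ne_zero).1 h1

lemma pi_div_mul_le_one {k : ℝ} (hk : 5 ≤ k) :
    π / (2 * k * (k + 1)) * ((k + 1) + ((k + 1) - 2) * √(k + 1)) ≤ 1 := by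
  have hs : 2 ≤ √(k + 1) := Real.le_sqrt_of_sq_le (by linarith)
  have hss : √(k + 1) * √(k + 1) = k + 1 := Real.mul_self_sqrt (by linarith)
  rw [div_mul_eq_mul_div, div_le_one (by positivity)]
  have h1 : (k + 1) + ((k + 1) - 2) * √(k + 1) ≤ (k + 1) ^ 2 / 2 := by
    nlinarith [mul_nonneg (mul_nonneg (by linarith : (0 : ℝ) ≤ k - 1) (sub_nonneg.2 hs))
      (Real.sqrt_nonneg (k + 1))]
  calc π * ((k + 1) + ((k + 1) - 2) * √(k + 1)) ≤ 3.15 * ((k + 1) ^ 2 / 2) := by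
        have := Real.pi_lt_d2
        gcongr
        nlinarith
      _ ≤ 2 * k * (k + 1) := by nlinarith

/-- Let k ≥ 5 be odd. For all x ∈ 𝒢_1 and z ∈ 𝒢_{k+1},
(π/(2k(k+1)))·((x_1+⋯+x_{k+1})/x_1 + (z_1+⋯+z_{k+1})/z_{k+1}) ≤ ‖x − z‖. -/
theorem case_j_eq_k_add_one (k : ℕ) (hk : 5 ≤ k) (hodd : Odd k)
    (x z : Euc (k+1)) (hx : x ∈ Gcal k 1) (hz : z ∈ Gcal k (k+1)) :
    π / (2 * (k : ℝ) * ((k : ℝ) + 1)) *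
      ((∑ i, x i) / x ⟨0, Nat.succ_pos k⟩
        + (∑ i, z i) / z ⟨k, Nat.lt_succ_self k⟩) ≤ ‖x - z‖ := by
  obtain ⟨hx1, hx2⟩ := hx
  obtain ⟨hz1, hz2⟩ := hz
  have hp : ∀ j, |x j| ≤ x ⟨0, Nat.succ_pos k⟩ := by
    simpa [gSign, gIdx] using hx2
  have hq : ∀ j, |(-z) j| ≤ (-z) ⟨k, Nat.lt_succ_self k⟩ := by
    simpa [gSign, gIdx, Nat.div_eq_of_lt (Nat.lt_succ_self k), hodd.neg_one_pow] using hz2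
  have h := sum_div_add_sum_div_le (by omega) (norm_eq_one_of_mem_usphere hx1)
    ((norm_neg z).trans (norm_eq_one_of_mem_usphere hz1)) hp hq
  simp only [PiLp.neg_apply, Finset.sum_neg_distrib, neg_div_neg_eq, ← sub_eq_add_neg] at h
  push_cast at h
  have hk' : (5 : ℝ) ≤ k := by exact_mod_cast hk
  calc _ ≤ π / (2 * (k : ℝ) * ((k : ℝ) + 1)) *
        ((((k : ℝ) + 1) + (((k : ℝ) + 1) - 2) * √((k : ℝ) + 1)) * ‖x - z‖) := by gcongr
    _ = π / (2 * (k : ℝ) * ((k : ℝ) + 1)) *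
        (((k : ℝ) + 1) + (((k : ℝ) + 1) - 2) * √((k : ℝ) + 1)) * ‖x - z‖ := by ring
    _ ≤ 1 * ‖x - z‖ := by gcongr; exact pi_div_mul_le_one hk'
    _ = ‖x - z‖ := one_mul _
end
end

section
/- Let k ≥ 3 be odd and 1 ≤ i ≤ j ≤ 2k+2. If (x,z) ∈ 𝒢_i × 𝒢_j attains the maximum value of D_{i,j} on 𝒢_i × 𝒢_j, then x lies in the boundary of 𝒢_i and z lies in the boundary of 𝒢_j (boundaries taken within S^k); equivalently, if x is an interior point of 𝒢_i or z is an interior point of 𝒢_j, then D_{i,j}(x,z) is strictly less than the supremum of D_{i,j}. -/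
open Real

noncomputable section

lemma arccos_cos_le_add (x y : ℝ) :
    Real.arccos (Real.cos y) ≤ Real.arccos (Real.cos x) + |y - x| := by
  set A := Real.arccos (Real.cos x) with hA
  have hA0 : 0 ≤ A := Real.arccos_nonneg _
  rcases le_or_gt π (A + |y - x|) with h | h
  · exact (Real.arccos_le_pi _).trans h
  have hcos : Real.cos A = Real.cos x :=
    Real.cos_arccos (Real.neg_one_le_cos x) (Real.cos_le_one x)
  obtain ⟨n, hn⟩ := Real.cos_eq_cos_iff.1 hcos
  have hab := le_abs_self (y - x)
  have hab' := neg_abs_le (y - x)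
  have key : Real.cos (A + |y - x|) ≤ Real.cos y := by
    rcases hn with hn | hn
    · have : Real.cos y = Real.cos |A + (y - x)| := by
        rw [Real.cos_abs, ← Real.cos_add_int_mul_two_pi (A + (y - x)) n]
        congr 1
        linarith
      rw [this]
      apply Real.cos_le_cos_of_nonneg_of_le_pi (abs_nonneg _) h.le
      rw [abs_le]
      constructor <;> linarith
    · have : Real.cos y = Real.cos |-A + (y - x)| := by
        rw [Real.cos_abs, ← Real.cos_add_int_mul_two_pi (-A + (y - x)) n]
        congr 1
        linarith
      rw [this]
      apply Real.cos_le_cos_of_nonneg_of_le_pi (abs_nonneg _) h.le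
      rw [abs_le]
      constructor <;> linarith
  calc Real.arccos (Real.cos y) ≤ Real.arccos (Real.cos (A + |y - x|)) :=
        Real.arccos_le_arccos key
    _ = A + |y - x| := Real.arccos_cos (by positivity) h.le

lemma abs_circleDist_sub_le (θ θ' φ : ℝ) :
    |circleDist θ' φ - circleDist θ φ| ≤ |θ' - θ| := by
  unfold circleDist
  have h1 := arccos_cos_le_add (θ - φ) (θ' - φ)
  have h2 := arccos_cos_le_add (θ' - φ) (θ - φ)
  rw [sub_sub_sub_cancel_right] at h1 h2
  rw [abs_sub_comm] at h2
  rw [abs_le]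
  constructor <;> linarith

lemma circleDist_comm (θ φ : ℝ) : circleDist θ φ = circleDist φ θ := by
  unfold circleDist
  rw [← Real.cos_neg, neg_sub]

lemma geoDist_comm {d : ℕ} (x y : Euc d) : geoDist x y = geoDist y x := by
  unfold geoDist
  rw [real_inner_comm]

lemma mem_usphere_iff_norm {n : ℕ} {x : Euc (n + 1)} : x ∈ usphere n ↔ ‖x‖ = 1 := by
  unfold usphere
  rw [Set.mem_ofPred_eq, real_inner_self_eq_norm_sq]
  constructor
  · intro h
    nlinarith [norm_nonneg x]
  · intro h
    rw [h]
    norm_num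

/-- The unit-speed great circle through `x` with initial velocity `v`. -/
def greatCircle {d : ℕ} (x v : Euc d) (t : ℝ) : Euc d := Real.cos t • x + Real.sin t • v

lemma greatCircle_apply {d : ℕ} (x v : Euc d) (t : ℝ) (j : Fin d) :
    greatCircle x v t j = Real.cos t * x j + Real.sin t * v j := by
  simp [greatCircle]

lemma inner_greatCircle {d : ℕ} {x v : Euc d} (hx : ‖x‖ = 1) (hv : ‖v‖ = 1)
    (hxv : inner ℝ x v = 0) (s t : ℝ) :
    inner ℝ (greatCircle x v s) (greatCircle x v t) = Real.cos (t - s) := by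
  have hvx : inner ℝ v x = 0 := by rw [real_inner_comm, hxv]
  simp only [greatCircle, inner_add_left, inner_add_right, real_inner_smul_left,
    real_inner_smul_right, real_inner_self_eq_norm_sq, hx, hv, hxv, hvx, Real.cos_sub]
  ring

lemma greatCircle_mem_usphere {n : ℕ} {x v : Euc (n + 1)} (hx : ‖x‖ = 1) (hv : ‖v‖ = 1)
    (hxv : inner ℝ x v = 0) (t : ℝ) : greatCircle x v t ∈ usphere n := by
  rw [usphere, Set.mem_ofPred_eq, inner_greatCircle hx hv hxv, sub_self, Real.cos_zero]

lemma exists_greatCircle_mem {k m : ℕ} {x v : Euc (k + 1)} (hx : ‖x‖ = 1) (hv : ‖v‖ = 1)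
    (hxv : inner ℝ x v = 0)
    (hint : ∃ ε > 0, ∀ y ∈ usphere k, dist y x < ε → y ∈ Gcal k m) :
    ∃ δ > 0, ∀ t, |t| < δ → greatCircle x v t ∈ Gcal k m := by
  obtain ⟨ε, hε, h⟩ := hint
  have hcont : Continuous (greatCircle x v) := by
    unfold greatCircle
    fun_prop
  obtain ⟨δ, hδ, hd⟩ := Metric.continuous_iff.1 hcont 0 ε hε
  refine ⟨δ, hδ, fun t ht => h _ (greatCircle_mem_usphere hx hv hxv t) ?_⟩
  simpa [greatCircle] using hd t (by simpa using ht)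

lemma exists_unit_orthogonal {d : ℕ} (hd : 2 ≤ d) (x : Euc d) :
    ∃ v : Euc d, ‖v‖ = 1 ∧ inner ℝ x v = 0 := by
  have hr : Module.finrank ℝ (Submodule.span ℝ {x})ᗮ ≠ 0 := by
    have h1 := Submodule.finrank_add_finrank_orthogonal (Submodule.span ℝ {x})
    have h2 : Module.finrank ℝ (Submodule.span ℝ {x}) ≤ 1 := by
      simpa using finrank_span_le_card (R := ℝ) ({x} : Set (Euc d))
    have h3 : Module.finrank ℝ (Euc d) = d := by simp
    omega
  have : Nontrivial (Submodule.span ℝ {x})ᗮ :=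
    Module.nontrivial_of_finrank_pos (Nat.pos_of_ne_zero hr)
  obtain ⟨w, hw⟩ := exists_ne (0 : (Submodule.span ℝ {x})ᗮ)
  have hw' : (w : Euc d) ≠ 0 := by simpa using hw
  refine ⟨‖(w : Euc d)‖⁻¹ • (w : Euc d), norm_smul_inv_norm hw', ?_⟩
  rw [real_inner_smul_right, Submodule.mem_orthogonal_singleton_iff_inner_right.1 w.2, mul_zero]

lemma exists_greatCircle_eq {d : ℕ} (hd : 2 ≤ d) {x z : Euc d} (hx : ‖x‖ = 1) (hz : ‖z‖ = 1) :
    ∃ v : Euc d, ‖v‖ = 1 ∧ inner ℝ x v = 0 ∧ z = greatCircle x v (geoDist x z) := by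
  set c : ℝ := inner ℝ x z with hc
  have habs : |c| ≤ 1 := by
    have := abs_real_inner_le_norm x z
    rwa [hx, hz, one_mul] at this
  obtain ⟨hc1, hc2⟩ := abs_le.1 habs
  have hnorm : ‖z - c • x‖ ^ 2 = 1 - c ^ 2 := by
    rw [← real_inner_self_eq_norm_sq, inner_sub_left, inner_sub_right, inner_sub_right,
      real_inner_smul_left, real_inner_smul_left, real_inner_smul_right, real_inner_smul_right,
      real_inner_self_eq_norm_sq, real_inner_self_eq_norm_sq, real_inner_comm, ← hc, hx, hz]
    ring
  have hsin : Real.sin (geoDist x z) = ‖z - c • x‖ := by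
    rw [geoDist, Real.sin_arccos, ← hc, ← hnorm, Real.sqrt_sq (norm_nonneg _)]
  have hcos : Real.cos (geoDist x z) = c := Real.cos_arccos hc1 hc2
  by_cases h0 : z - c • x = 0
  · obtain ⟨v, hv, hxv⟩ := exists_unit_orthogonal hd x
    refine ⟨v, hv, hxv, ?_⟩
    rw [greatCircle, hcos, hsin, h0, norm_zero, zero_smul, add_zero]
    exact sub_eq_zero.1 h0
  · refine ⟨‖z - c • x‖⁻¹ • (z - c • x), norm_smul_inv_norm h0, ?_, ?_⟩
    · rw [real_inner_smul_right, inner_sub_right, real_inner_smul_right,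
        real_inner_self_eq_norm_sq, hx, ← hc]
      ring
    · rw [greatCircle, hcos, hsin, smul_smul, mul_inv_cancel₀ (norm_ne_zero_iff.2 h0), one_smul]
      abel

lemma sum_sq_of_norm_eq_one {d : ℕ} {x : Euc d} (hx : ‖x‖ = 1) : ∑ j, x j ^ 2 = 1 := by
  have := EuclideanSpace.real_norm_sq_eq x
  rw [hx] at this
  linarith

lemma abs_gSign (k m : ℕ) : |gSign k m| = 1 := by
  simp [gSign]

lemma abs_apply_le_of_mem_Gcal {k m : ℕ} {x : Euc (k + 1)} (hx : x ∈ Gcal k m) (j : Fin (k + 1)) :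
    |x j| ≤ |x (gIdx k m)| := by
  have h := (hx.2 j).trans (le_abs_self _)
  rwa [abs_mul, abs_gSign, one_mul] at h

lemma one_le_of_mem_Gcal {k m : ℕ} {x : Euc (k + 1)} (hx : x ∈ Gcal k m) :
    1 ≤ ((k : ℝ) + 1) * x (gIdx k m) ^ 2 := by
  have h1 := sum_sq_of_norm_eq_one (mem_usphere_iff_norm.1 hx.1)
  have h2 : ∑ j, x j ^ 2 ≤ ∑ _j : Fin (k + 1), x (gIdx k m) ^ 2 :=
    Finset.sum_le_sum fun j _ => sq_le_sq.2 (abs_apply_le_of_mem_Gcal hx j)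
  rw [h1] at h2
  simpa using h2

lemma apply_gIdx_ne_zero_of_mem_Gcal {k m : ℕ} {x : Euc (k + 1)} (hx : x ∈ Gcal k m) :
    x (gIdx k m) ≠ 0 := by
  intro h
  have := one_le_of_mem_Gcal hx
  rw [h] at this
  norm_num at this

lemma gSign_mul_pos_of_mem_Gcal {k m : ℕ} {x : Euc (k + 1)} (hx : x ∈ Gcal k m) :
    0 < gSign k m * x (gIdx k m) :=
  (abs_pos.2 (apply_gIdx_ne_zero_of_mem_Gcal hx)).trans_le (hx.2 _)

lemma sq_cross_le {k : ℕ} (a : Fin (k + 1)) {s x v : Fin (k + 1) → ℝ} (hsa : s a = 0)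
    (hs : ∀ j, |s j| ≤ 1) (hx : ∀ j, |x j| ≤ |x a|) (hv : ∑ j, v j ^ 2 = 1) :
    ((∑ j, s j * v j) * x a - (∑ j, s j * x j) * v a) ^ 2 ≤
      (k : ℝ) * ((k : ℝ) + 1) * x a ^ 2 := by
  set N := ∑ j, s j * x j with hN
  have hNle : |N| ≤ k * |x a| := by
    rw [hN, Fin.sum_univ_succAbove _ a, hsa, zero_mul, zero_add]
    calc |∑ i, s (a.succAbove i) * x (a.succAbove i)|
        ≤ ∑ i, |s (a.succAbove i) * x (a.succAbove i)| := Finset.abs_sum_le_sum_abs _ _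
      _ ≤ ∑ _i : Fin k, |x a| := by
        refine Finset.sum_le_sum fun i _ => ?_
        rw [abs_mul]
        calc _ ≤ 1 * |x a| := mul_le_mul (hs _) (hx _) (abs_nonneg _) zero_le_one
          _ = |x a| := one_mul _
      _ = k * |x a| := by simp
  have hNsq : N ^ 2 ≤ k ^ 2 * x a ^ 2 := by
    rw [← sq_abs N, ← sq_abs (x a), ← mul_pow]
    exact pow_le_pow_left₀ (abs_nonneg _) hNle 2
  have hCS := Finset.sum_mul_sq_le_sq_mul_sq Finset.univ
    (fun j => s j * x a - (if j = a then N else 0)) v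
  have hlhs : ∑ j, (s j * x a - (if j = a then N else 0)) * v j =
      (∑ j, s j * v j) * x a - N * v a := by
    simp only [sub_mul, Finset.sum_sub_distrib, Finset.sum_mul, ite_mul, zero_mul,
      Finset.sum_ite_eq', Finset.mem_univ, if_true]
    congr 1
    exact Finset.sum_congr rfl fun j _ => by ring
  have hrhs : ∑ j, (s j * x a - (if j = a then N else 0)) ^ 2 ≤ N ^ 2 + k * x a ^ 2 := by
    rw [Fin.sum_univ_succAbove _ a]
    have : ∑ i : Fin k, (s (a.succAbove i) * x a - (if a.succAbove i = a then N else 0)) ^ 2 ≤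
        ∑ _i : Fin k, x a ^ 2 := by
      refine Finset.sum_le_sum fun i _ => ?_
      rw [if_neg (Fin.succAbove_ne a i), sub_zero, mul_pow]
      have h1 : s (a.succAbove i) ^ 2 ≤ 1 := (sq_le_one_iff_abs_le_one _).2 (hs _)
      nlinarith [sq_nonneg (x a)]
    have h2 : ∑ _i : Fin k, x a ^ 2 = k * x a ^ 2 := by simp
    simp only [hsa, if_true, zero_mul, zero_sub, neg_sq]
    linarith
  rw [hlhs, hv, mul_one] at hCS
  nlinarith

/-- The coefficients of the linear form in the numerator of `fFun k m`. -/
def fCoeff (k m : ℕ) (j : Fin (k + 1)) : ℝ :=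
  if (j : ℕ) < (m - 1) % (k + 1) then (1 : ℝ)
  else if (j : ℕ) = (m - 1) % (k + 1) then 0 else -1

lemma abs_fCoeff_le (k m : ℕ) (j : Fin (k + 1)) : |fCoeff k m j| ≤ 1 := by
  unfold fCoeff
  split_ifs <;> simp

lemma fCoeff_gIdx (k m : ℕ) : fCoeff k m (gIdx k m) = 0 := by
  simp [fCoeff, gIdx]

lemma fFun_eq (k m : ℕ) (x : Euc (k + 1)) :
    fFun k m x = ((m : ℝ) - 1) * π / ((k : ℝ) + 1) + π / (2 * (k : ℝ) * ((k : ℝ) + 1)) *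
      ((∑ j, fCoeff k m j * x j) / x (gIdx k m)) := rfl

/-- Along a great circle, `fFun` is Lipschitz with a constant smaller than one. -/
lemma abs_fFun_greatCircle_sub_lt {k m : ℕ} (hk : 3 ≤ k) {x v : Euc (k + 1)}
    (hv : ‖v‖ = 1) {t : ℝ} (ht : t ≠ 0) (hx : x ∈ Gcal k m)
    (hy : greatCircle x v t ∈ Gcal k m) :
    |fFun k m (greatCircle x v t) - fFun k m x| < |t| := by
  have hcross := sq_cross_le (gIdx k m) (fCoeff_gIdx k m) (abs_fCoeff_le k m)
    (abs_apply_le_of_mem_Gcal hx)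
    (sum_sq_of_norm_eq_one hv)
  have hx0 := apply_gIdx_ne_zero_of_mem_Gcal hx
  have hy0 := apply_gIdx_ne_zero_of_mem_Gcal hy
  have hy1 := one_le_of_mem_Gcal hy
  have hk' : (3 : ℝ) ≤ k := by exact_mod_cast hk
  set a := gIdx k m
  set N := ∑ j, fCoeff k m j * x j with hN
  set M := ∑ j, fCoeff k m j * v j with hM
  set y := greatCircle x v t with hyd
  have hsum : ∑ j, fCoeff k m j * y j = Real.cos t * N + Real.sin t * M := by
    rw [hN, hM, Finset.mul_sum, Finset.mul_sum, ← Finset.sum_add_distrib]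
    refine Finset.sum_congr rfl fun j _ => ?_
    rw [hyd, greatCircle_apply]
    ring
  have hya : y a = Real.cos t * x a + Real.sin t * v a := greatCircle_apply x v t a
  set W := M * x a - N * v a with hW
  have hdiff : fFun k m y - fFun k m x =
      Real.sin t * (π / (2 * (k : ℝ) * ((k : ℝ) + 1)) * (W / (y a * x a))) := by
    have hrat : (Real.cos t * N + Real.sin t * M) / y a - N / x a =
        Real.sin t * (W / (y a * x a)) := by
      rw [div_sub_div _ _ hy0 hx0, ← mul_div_assoc]
      congr 1
      rw [hya, hW]
      ring
    rw [fFun_eq, fFun_eq, hsum, add_sub_add_left_eq_sub, ← mul_sub, hrat]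
    ring
  have hsq : (π / (2 * (k : ℝ) * ((k : ℝ) + 1)) * (W / (y a * x a))) ^ 2 < 1 := by
    have hxpos : 0 < x a ^ 2 := by positivity
    have hypos : 0 < y a ^ 2 := by positivity
    have hpi : π ^ 2 < 12 := by nlinarith [Real.pi_lt_d2, Real.pi_pos]
    rw [div_mul_div_comm, div_pow, div_lt_one (by positivity), mul_pow]
    calc π ^ 2 * W ^ 2 ≤ π ^ 2 * (k * (k + 1) * x a ^ 2) := by gcongr
      _ < 12 * (k * (k + 1) * x a ^ 2) := by gcongr
      _ = 4 * k * (k + 1) * x a ^ 2 * (3 * 1) := by ring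
      _ ≤ 4 * k * (k + 1) * x a ^ 2 * (k * ((k + 1) * y a ^ 2)) := by gcongr
      _ = (2 * k * (k + 1) * (y a * x a)) ^ 2 := by ring
  have hlt : |π / (2 * (k : ℝ) * ((k : ℝ) + 1)) * (W / (y a * x a))| < 1 :=
    (sq_lt_one_iff_abs_lt_one _).1 hsq
  rw [hdiff, abs_mul]
  calc |Real.sin t| * |π / (2 * (k : ℝ) * ((k : ℝ) + 1)) * (W / (y a * x a))|
      ≤ |t| * |π / (2 * (k : ℝ) * ((k : ℝ) + 1)) * (W / (y a * x a))| := by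
        exact mul_le_mul_of_nonneg_right Real.abs_sin_le_abs (abs_nonneg _)
    _ < |t| * 1 := by
        have := abs_pos.2 ht
        gcongr
    _ = |t| := mul_one _

/-- At an interior point of a cell no other coordinate has maximal absolute value. -/
lemma gIdx_eq_of_interior {k m : ℕ} {x : Euc (k + 1)} (hx : x ∈ Gcal k m)
    (hint : ∃ ε > 0, ∀ y ∈ usphere k, dist y x < ε → y ∈ Gcal k m)
    {b : Fin (k + 1)} (hb : |x b| = |x (gIdx k m)|) : b = gIdx k m := by
  by_contra hne
  set a := gIdx k m with ha
  have hxa : x a ≠ 0 := apply_gIdx_ne_zero_of_mem_Gcal hx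
  have hxn := mem_usphere_iff_norm.1 hx.1
  set w : Euc (k + 1) := x a • EuclideanSpace.single b 1 - x b • EuclideanSpace.single a 1 with hw
  have hwa : w a = -x b := by simp [hw, Ne.symm hne]
  have hwb : w b = x a := by simp [hw, hne]
  have hw0 : w ≠ 0 := by
    intro h
    rw [h] at hwb
    exact hxa (by simpa using hwb.symm)
  have hxw : inner ℝ x w = 0 := by
    simp [hw, inner_sub_right, real_inner_smul_right, EuclideanSpace.inner_single_right]
    ring
  have hr : 0 < ‖w‖⁻¹ := inv_pos.2 (norm_pos_iff.2 hw0)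
  obtain ⟨δ, hδ, hmem⟩ := exists_greatCircle_mem (v := ‖w‖⁻¹ • w) hxn (norm_smul_inv_norm hw0)
    (by rw [real_inner_smul_right, hxw, mul_zero]) hint
  set τ := min (δ / 2) 1
  have hτ0 : 0 < τ := lt_min (by linarith) one_pos
  have hτδ : τ < δ := (min_le_left _ _).trans_lt (by linarith)
  have hτ1 : τ ≤ 1 := min_le_right _ _
  have hsin : 0 < Real.sin τ :=
    Real.sin_pos_of_pos_of_lt_pi hτ0 (by linarith [Real.pi_gt_three])
  have hcos : 0 < Real.cos τ :=
    Real.cos_pos_of_mem_Ioo ⟨by linarith [Real.pi_gt_three], by linarith [Real.pi_gt_three]⟩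
  have hsq : x b ^ 2 = x a ^ 2 := sq_eq_sq_iff_abs_eq_abs _ _ |>.2 hb
  have key : ∀ t, |t| < δ → Real.cos t * Real.sin t * (x a * x b) ≤ 0 := by
    intro t ht
    have h := sq_le_sq.2 (abs_apply_le_of_mem_Gcal (hmem t ht) b)
    rw [← ha, greatCircle_apply, greatCircle_apply] at h
    simp only [PiLp.smul_apply, smul_eq_mul, hwa, hwb] at h
    have e₁ : Real.cos t ^ 2 * x b ^ 2 = Real.cos t ^ 2 * x a ^ 2 := by rw [hsq]
    have e₂ : (Real.sin t * ‖w‖⁻¹) ^ 2 * x b ^ 2 = (Real.sin t * ‖w‖⁻¹) ^ 2 * x a ^ 2 := by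
      rw [hsq]
    have h' : ‖w‖⁻¹ * (Real.cos t * Real.sin t * (x a * x b)) ≤ ‖w‖⁻¹ * 0 := by
      nlinarith
    exact le_of_mul_le_mul_left h' hr
  have h1 := key τ (by rwa [abs_of_pos hτ0])
  have h2 := key (-τ) (by rwa [abs_neg, abs_of_pos hτ0])
  rw [Real.cos_neg, Real.sin_neg] at h2
  have hcs : 0 < Real.cos τ * Real.sin τ := mul_pos hcos hsin
  have h3 : x a * x b = 0 := by nlinarith
  have h4 : x b = 0 := (mul_eq_zero.1 h3).resolve_left hxa
  rw [h4, abs_zero] at hb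
  exact hxa (abs_eq_zero.1 hb.symm)

lemma gSign_eq_of_pos {k i j : ℕ} {c : ℝ} (hi : 0 < gSign k i * c) (hj : 0 < gSign k j * c) :
    gSign k i = gSign k j := by
  rcases eq_or_eq_neg_of_abs_eq (abs_gSign k i) with h | h <;>
  rcases eq_or_eq_neg_of_abs_eq (abs_gSign k j) with h' | h' <;>
  rw [h] at hi ⊢ <;> rw [h'] at hj ⊢ <;> linarith

lemma gSign_eq_iff {k i j : ℕ} (hidx : gIdx k i = gIdx k j) (hi1 : 1 ≤ i) (hi : i ≤ 2 * k + 2)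
    (hj1 : 1 ≤ j) (hj : j ≤ 2 * k + 2) : gSign k i = gSign k j ↔ i = j := by
  refine ⟨fun h => ?_, fun h => by rw [h]⟩
  have hmod : (i - 1) % (k + 1) = (j - 1) % (k + 1) := congrArg Fin.val hidx
  have hqi : (i - 1) / (k + 1) < 2 := Nat.div_lt_of_lt_mul (by omega)
  have hqj : (j - 1) / (k + 1) < 2 := Nat.div_lt_of_lt_mul (by omega)
  have hi' := Nat.div_add_mod (i - 1) (k + 1)
  have hj' := Nat.div_add_mod (j - 1) (k + 1)
  unfold gSign at h
  rw [hmod, pow_add, pow_add, mul_right_inj' (by positivity)] at h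
  have hq : (i - 1) / (k + 1) = (j - 1) / (k + 1) := by
    generalize (i - 1) / (k + 1) = p at *
    generalize (j - 1) / (k + 1) = q at *
    interval_cases p <;> interval_cases q <;> first | rfl | norm_num at h
  rw [hq, hmod, hj'] at hi'
  omega

lemma eq_add_or_of_ne {k i j : ℕ} (hidx : gIdx k i = gIdx k j) (hi1 : 1 ≤ i)
    (hi : i ≤ 2 * k + 2) (hj1 : 1 ≤ j) (hj : j ≤ 2 * k + 2) (hne : i ≠ j) :
    i = j + (k + 1) ∨ j = i + (k + 1) := by
  have hmod : (i - 1) % (k + 1) = (j - 1) % (k + 1) := congrArg Fin.val hidx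
  have hqi : (i - 1) / (k + 1) < 2 := Nat.div_lt_of_lt_mul (by omega)
  have hqj : (j - 1) / (k + 1) < 2 := Nat.div_lt_of_lt_mul (by omega)
  have hi' := Nat.div_add_mod (i - 1) (k + 1)
  have hj' := Nat.div_add_mod (j - 1) (k + 1)
  rw [hmod] at hi'
  generalize (i - 1) / (k + 1) = p at *
  generalize (j - 1) / (k + 1) = q at *
  interval_cases p <;> interval_cases q <;> omega

lemma fFun_add_neg (k m : ℕ) (hm : 1 ≤ m) (x : Euc (k + 1)) :
    fFun k (m + (k + 1)) (-x) = fFun k m x + π := by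
  have hmod : (m + (k + 1) - 1) % (k + 1) = (m - 1) % (k + 1) := by
    rw [show m + (k + 1) - 1 = m - 1 + (k + 1) by omega, Nat.add_mod_right]
  have hidx : gIdx k (m + (k + 1)) = gIdx k m := Fin.ext hmod
  have hcoef : fCoeff k (m + (k + 1)) = fCoeff k m := by
    funext j
    simp only [fCoeff, hmod]
  have hk : (k : ℝ) + 1 ≠ 0 := by positivity
  rw [fFun_eq, fFun_eq, hidx, hcoef]
  simp only [PiLp.neg_apply, mul_neg, Finset.sum_neg_distrib, neg_div_neg_eq]
  push_cast
  field_simp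
  ring

lemma circleDist_eq_zero_of_interior {k i j : ℕ} (hi1 : 1 ≤ i) (hi : i ≤ 2 * k + 2)
    (hj1 : 1 ≤ j) (hj : j ≤ 2 * k + 2) {x : Euc (k + 1)} (hx : x ∈ Gcal k i)
    (hint : ∃ ε > 0, ∀ y ∈ usphere k, dist y x < ε → y ∈ Gcal k i) (hz : x ∈ Gcal k j) :
    circleDist (fFun k i x) (fFun k j x) = 0 := by
  have hidx := gIdx_eq_of_interior hx hint
    (le_antisymm (abs_apply_le_of_mem_Gcal hx _) (abs_apply_le_of_mem_Gcal hz _))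
  have h := gSign_mul_pos_of_mem_Gcal hz
  rw [hidx] at h
  have hij := (gSign_eq_iff hidx hj1 hj hi1 hi).1 (gSign_eq_of_pos h (gSign_mul_pos_of_mem_Gcal hx))
  simp [hij, circleDist]

lemma circleDist_eq_pi_of_interior {k i j : ℕ} (hi1 : 1 ≤ i) (hi : i ≤ 2 * k + 2)
    (hj1 : 1 ≤ j) (hj : j ≤ 2 * k + 2) {x : Euc (k + 1)} (hx : x ∈ Gcal k i)
    (hint : ∃ ε > 0, ∀ y ∈ usphere k, dist y x < ε → y ∈ Gcal k i) (hz : -x ∈ Gcal k j) :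
    circleDist (fFun k i x) (fFun k j (-x)) = π := by
  have hle := abs_apply_le_of_mem_Gcal hz (gIdx k i)
  simp only [PiLp.neg_apply, abs_neg] at hle
  have hidx := gIdx_eq_of_interior hx hint (le_antisymm (abs_apply_le_of_mem_Gcal hx _) hle)
  have hne : j ≠ i := by
    rintro rfl
    have h := gSign_mul_pos_of_mem_Gcal hz
    rw [PiLp.neg_apply, mul_neg] at h
    linarith [gSign_mul_pos_of_mem_Gcal hx]
  rcases eq_add_or_of_ne hidx hj1 hj hi1 hi hne with rfl | rfl
  · rw [fFun_add_neg k i hi1, circleDist]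
    simp
  · have := fFun_add_neg k j hj1 (-x)
    rw [neg_neg] at this
    rw [this, circleDist]
    simp

lemma not_interior_of_max {k : ℕ} (hk : 3 ≤ k) {i j : ℕ} (hi1 : 1 ≤ i) (hi : i ≤ 2 * k + 2)
    (hj1 : 1 ≤ j) (hj : j ≤ 2 * k + 2) {x z : Euc (k + 1)} (hx : x ∈ Gcal k i)
    (hz : z ∈ Gcal k j)
    (hmax : ∀ x' ∈ Gcal k i,
      |circleDist (fFun k i x') (fFun k j z) - geoDist x' z| ≤
        |circleDist (fFun k i x) (fFun k j z) - geoDist x z|) :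
    ¬ ∃ ε > 0, ∀ y ∈ usphere k, dist y x < ε → y ∈ Gcal k i := by
  intro hint
  have hxn := mem_usphere_iff_norm.1 hx.1
  have hzn := mem_usphere_iff_norm.1 hz.1
  obtain ⟨v, hv, hxv, hzv⟩ := exists_greatCircle_eq (by omega) hxn hzn
  obtain ⟨δ, hδ, hmem⟩ := exists_greatCircle_mem hxn hv hxv hint
  set C := circleDist (fFun k i x) (fFun k j z) with hC
  set d := geoDist x z with hd
  have hd0 : 0 ≤ d := Real.arccos_nonneg _
  have hdpi : d ≤ π := Real.arccos_le_pi _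
  have hgeo : ∀ t, 0 ≤ d - t → d - t ≤ π → geoDist (greatCircle x v t) z = d - t := by
    intro t h1 h2
    rw [hzv, geoDist, inner_greatCircle hxn hv hxv, Real.arccos_cos h1 h2]
  have hcirc : ∀ t, t ≠ 0 → |t| < δ →
      |circleDist (fFun k i (greatCircle x v t)) (fFun k j z) - C| < |t| := fun t ht htδ =>
    (abs_circleDist_sub_le _ _ _).trans_lt
      (abs_fFun_greatCircle_sub_lt hk hv ht hx (hmem t htδ))
  have toward : d ≤ C → d ≤ 0 := by
    intro hCd
    by_contra! hpos
    set t := min (δ / 2) d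
    have ht0 : 0 < t := lt_min (by linarith) hpos
    have htδ : t < δ := (min_le_left _ _).trans_lt (by linarith)
    have htd : t ≤ d := min_le_right _ _
    have h1 := hcirc t ht0.ne' (by rwa [abs_of_pos ht0])
    have h2 := hmax _ (hmem t (by rwa [abs_of_pos ht0]))
    rw [hgeo t (by linarith) (by linarith), abs_of_nonneg (sub_nonneg.2 hCd)] at h2
    rw [abs_of_pos ht0, abs_lt] at h1
    linarith [(abs_le.1 h2).2]
  have away : C ≤ d → π ≤ d := by
    intro hCd
    by_contra! hlt
    set t := min (δ / 2) (π - d)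
    have ht0 : 0 < t := lt_min (by linarith) (by linarith)
    have htδ : t < δ := (min_le_left _ _).trans_lt (by linarith)
    have htd : t ≤ π - d := min_le_right _ _
    have habs : |-t| = t := by rw [abs_neg, abs_of_pos ht0]
    have h1 := hcirc (-t) (neg_ne_zero.2 ht0.ne') (by rwa [habs])
    have h2 := hmax _ (hmem (-t) (by rwa [habs]))
    rw [hgeo (-t) (by linarith) (by linarith), abs_of_nonpos (sub_nonpos.2 hCd)] at h2
    rw [habs, abs_lt] at h1
    linarith [(abs_le.1 h2).1]
  have hpi := Real.pi_pos
  rcases le_total d C with h | h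
  · have hd' : d = 0 := le_antisymm (toward h) hd0
    have hzx : z = x := by rw [hzv, hd']; simp [greatCircle]
    have hC0 : C = 0 := by
      rw [hC, hzx]
      exact circleDist_eq_zero_of_interior hi1 hi hj1 hj hx hint (hzx ▸ hz)
    linarith [away (by linarith)]
  · have hd' : d = π := le_antisymm hdpi (away h)
    have hzx : z = -x := by rw [hzv, hd']; simp [greatCircle]
    have hCpi : C = π := by
      rw [hC, hzx]
      exact circleDist_eq_pi_of_interior hi1 hi hj1 hj hx hint (hzx ▸ hz)
    linarith [toward (by linarith)]

/-- Let k ≥ 3 be odd and 1 ≤ i ≤ j ≤ 2k+2. If (x,z) ∈ 𝒢_i × 𝒢_j attains the maximum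
of D_{i,j}(x',z') = |d_{S¹}(f_i(x'), f_j(z')) − d_{S^k}(x',z')| on 𝒢_i × 𝒢_j, then x lies
in the boundary of 𝒢_i and z lies in the boundary of 𝒢_j, boundaries taken within S^k
(i.e. neither x nor z is an interior point of its cell relative to the sphere). -/
theorem D_max_on_boundary (k : ℕ) (hk : 3 ≤ k) (hodd : Odd k) (i j : ℕ)
    (hi : 1 ≤ i) (hij : i ≤ j) (hj : j ≤ 2*k+2)
    (x z : Euc (k+1)) (hx : x ∈ Gcal k i) (hz : z ∈ Gcal k j)
    (hmax : ∀ x' ∈ Gcal k i, ∀ z' ∈ Gcal k j,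
      |circleDist (fFun k i x') (fFun k j z') - geoDist x' z'| ≤
        |circleDist (fFun k i x) (fFun k j z) - geoDist x z|) :
    (¬ ∃ ε > 0, ∀ y ∈ usphere k, dist y x < ε → y ∈ Gcal k i) ∧
    (¬ ∃ ε > 0, ∀ y ∈ usphere k, dist y z < ε → y ∈ Gcal k j) := by
  refine ⟨not_interior_of_max hk hi (hij.trans hj) (hi.trans hij) hj hx hz
      fun x' hx' => hmax x' hx' z hz,
    not_interior_of_max hk (hi.trans hij) hj hi (hij.trans hj) hz hx fun z' hz' => ?_⟩
  rw [circleDist_comm _ (fFun k i x), geoDist_comm _ x, circleDist_comm _ (fFun k i x),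
    geoDist_comm z x]
  exact hmax x hx z' hz'
end
end

section
/- For all integers 2 ≤ n < k < ∞, there exists an antipodal set P ⊆ S^n consisting of 2(k+1) points such that vdiam_{S^n}(P) ≤ πn/(n+1) and sep_{S^n}(P) ≥ π/(2(⌈(k−n)/(n(n+1))⌉ + 1)) ≥ π/(k−n+3). -/
open Real

noncomputable section

/-- The separation of a set P: the infimum of geodesic distances between distinct points. -/
def sepS {d : ℕ} (P : Set (Euc d)) : ℝ :=
  sInf {t | ∃ p ∈ P, ∃ q ∈ P, p ≠ q ∧ t = geoDist p q}

/-- The diameter of a set with respect to the geodesic metric. -/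
def geoDiam {d : ℕ} (A : Set (Euc d)) : ℝ :=
  sSup {t | ∃ x ∈ A, ∃ y ∈ A, t = geoDist x y}

/-- The Voronoi cell of p with respect to the point set P, within the ambient set S:
all x ∈ S at least as close (geodesically) to p as to every point of P. -/
def vcell {d : ℕ} (S P : Set (Euc d)) (p : Euc d) : Set (Euc d) :=
  {x ∈ S | ∀ q ∈ P, geoDist x p ≤ geoDist x q}

/-- The Voronoi diameter of the point set P in the ambient set S:
the supremum of the diameters of the Voronoi cells of the points of P. -/
def vdiam {d : ℕ} (S P : Set (Euc d)) : ℝ :=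
  sSup {t | ∃ p ∈ P, t = geoDiam (vcell S P p)}

section UnitVectors

variable {d : ℕ}

theorem inner_mem_Icc_of_unit {x y : Euc d} (hx : inner ℝ x x = (1 : ℝ))
    (hy : inner ℝ y y = (1 : ℝ)) : inner ℝ x y ∈ Set.Icc (-1 : ℝ) 1 := by
  have hx' : ‖x‖ = 1 := by
    rw [real_inner_self_eq_norm_sq] at hx
    exact (pow_eq_one_iff_of_nonneg (norm_nonneg x) two_ne_zero).1 hx
  have hy' : ‖y‖ = 1 := by
    rw [real_inner_self_eq_norm_sq] at hy
    exact (pow_eq_one_iff_of_nonneg (norm_nonneg y) two_ne_zero).1 hy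
  have h := abs_real_inner_le_norm x y
  rw [hx', hy', one_mul] at h
  exact abs_le.1 h

/-- Unit vectors within angle `arccos √c` of `p` are within angle `2 arccos √c` of each other;
here `cos (2 arccos √c) = 2 c - 1`. -/
theorem inner_ge_of_inner_sq_ge {x y p : Euc d} {c : ℝ} (hx : inner ℝ x x = (1 : ℝ))
    (hy : inner ℝ y y = (1 : ℝ)) (hp : inner ℝ p p = (1 : ℝ))
    (hxp : 0 ≤ (inner ℝ x p : ℝ)) (hyp : 0 ≤ (inner ℝ y p : ℝ))
    (hxc : c ≤ (inner ℝ x p : ℝ) ^ 2) (hyc : c ≤ (inner ℝ y p : ℝ) ^ 2) :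
    2 * c - 1 ≤ inner ℝ x y := by
  set s : ℝ := inner ℝ x p with hs
  set t : ℝ := inner ℝ y p with ht
  have h : (0 : ℝ) ≤ inner ℝ ((x - s • p) + (y - t • p)) ((x - s • p) + (y - t • p)) :=
    real_inner_self_nonneg
  have e : (inner ℝ ((x - s • p) + (y - t • p)) ((x - s • p) + (y - t • p)) : ℝ)
      = (1 - s ^ 2) + (1 - t ^ 2) + 2 * (inner ℝ x y - s * t) := by
    simp only [inner_add_left, inner_add_right, inner_sub_left, inner_sub_right,
      real_inner_smul_left, real_inner_smul_right, real_inner_comm x p, real_inner_comm y p,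
      real_inner_comm x y, hx, hy, hp, ← hs, ← ht]
    ring
  have hst : c ≤ s * t := by
    rcases le_total s t with hle | hle <;> nlinarith
  nlinarith

end UnitVectors

section Voronoi

variable {n : ℕ}

theorem inner_le_of_mem_vcell {P : Set (Euc (n + 1))} (hP : P ⊆ usphere n) {p q x : Euc (n + 1)}
    (hp : p ∈ P) (hq : q ∈ P) (hx : x ∈ vcell (usphere n) P p) :
    (inner ℝ x q : ℝ) ≤ inner ℝ x p := by
  have h := hx.2 q hq
  have hxu : inner ℝ x x = (1 : ℝ) := hx.1
  exact (Real.strictAntiOn_arccos.le_iff_ge (inner_mem_Icc_of_unit hxu (hP hp))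
    (inner_mem_Icc_of_unit hxu (hP hq))).1 h

theorem one_div_le_inner_sq_of_mem_vcell {P : Set (Euc (n + 1))} (hP : P ⊆ usphere n)
    (hneg : ∀ x ∈ P, -x ∈ P) (hbasis : ∀ i, EuclideanSpace.single i (1 : ℝ) ∈ P)
    {p x : Euc (n + 1)} (hp : p ∈ P) (hx : x ∈ vcell (usphere n) P p) :
    0 ≤ (inner ℝ x p : ℝ) ∧ 1 / ((n : ℝ) + 1) ≤ (inner ℝ x p : ℝ) ^ 2 := by
  have hcoord : ∀ i, |x i| ≤ (inner ℝ x p : ℝ) := by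
    intro i
    have h1 := inner_le_of_mem_vcell hP hp (hbasis i) hx
    have h2 := inner_le_of_mem_vcell hP hp (hneg _ (hbasis i)) hx
    simp only [inner_neg_right, EuclideanSpace.inner_single_right] at h1 h2
    simp only [one_mul, conj_trivial] at h1 h2
    exact abs_le.2 ⟨by linarith, h1⟩
  refine ⟨(abs_nonneg _).trans (hcoord 0), ?_⟩
  have hxx : inner ℝ x x = (1 : ℝ) := hx.1
  rw [real_inner_self_eq_norm_sq, EuclideanSpace.real_norm_sq_eq] at hxx
  have hsum : ∑ i, x i ^ 2 ≤ ∑ _i : Fin (n + 1), (inner ℝ x p : ℝ) ^ 2 :=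
    Finset.sum_le_sum fun i _ => sq_le_sq' (by linarith [(abs_le.1 (hcoord i)).1])
      (abs_le.1 (hcoord i)).2
  rw [hxx, Finset.sum_const, Finset.card_univ, Fintype.card_fin, nsmul_eq_mul] at hsum
  rw [div_le_iff₀ (by positivity)]
  push_cast at hsum
  linarith

theorem arccos_le_pi_mul_div (hn : 2 ≤ n) :
    Real.arccos (2 * (1 / ((n : ℝ) + 1)) - 1) ≤ π * n / ((n : ℝ) + 1) := by
  have hn' : (2 : ℝ) ≤ n := by exact_mod_cast hn
  have hθ : π * n / ((n : ℝ) + 1) = π - π / ((n : ℝ) + 1) := by field_simp; ring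
  have hle : π / ((n : ℝ) + 1) ≤ π := div_le_self pi_pos.le (by linarith)
  have hpos : 0 ≤ π / ((n : ℝ) + 1) := by positivity
  rw [hθ, ← Real.arccos_cos (x := π - π / ((n : ℝ) + 1)) (by linarith) (by linarith)]
  apply Real.antitone_arccos
  rw [Real.cos_pi_sub]
  have h1 := Real.one_sub_sq_div_two_le_cos (x := π / ((n : ℝ) + 1))
  have h2 : (π / ((n : ℝ) + 1)) ^ 2 / 2 ≤ 2 * (1 / ((n : ℝ) + 1)) := by
    rw [div_pow, div_div, mul_one_div, div_le_div_iff₀ (by positivity) (by positivity)]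
    have hpi : π ^ 2 ≤ 12 := by nlinarith [pi_lt_d2, pi_pos]
    nlinarith [mul_nonneg (by linarith : (0 : ℝ) ≤ n + 1)
      (by linarith : (0 : ℝ) ≤ 4 * (n + 1) - π ^ 2)]
  linarith

/-- An antipodal set containing the vertices of the cross-polytope has Voronoi diameter at most
that of the cross-polytope. -/
theorem vdiam_le_of_single_mem (hn : 2 ≤ n) {P : Set (Euc (n + 1))} (hP : P ⊆ usphere n)
    (hneg : ∀ x ∈ P, -x ∈ P) (hbasis : ∀ i, EuclideanSpace.single i (1 : ℝ) ∈ P) :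
    vdiam (usphere n) P ≤ π * n / ((n : ℝ) + 1) := by
  have h0 : 0 ≤ π * n / ((n : ℝ) + 1) := by positivity
  refine Real.sSup_le ?_ h0
  rintro _ ⟨p, hp, rfl⟩
  refine Real.sSup_le ?_ h0
  rintro _ ⟨x, hx, y, hy, rfl⟩
  obtain ⟨hx0, hx1⟩ := one_div_le_inner_sq_of_mem_vcell hP hneg hbasis hp hx
  obtain ⟨hy0, hy1⟩ := one_div_le_inner_sq_of_mem_vcell hP hneg hbasis hp hy
  exact (Real.antitone_arccos (inner_ge_of_inner_sq_ge hx.1 hy.1 (hP hp) hx0 hy0 hx1 hy1)).trans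
    (arccos_le_pi_mul_div hn)

end Voronoi

section Separation

variable {d : ℕ} {ι : Type*}

/-- The antipodal set `{±v a : a ∈ T}`. -/
def symmetrization (v : ι → Euc d) (T : Finset ι) : Set (Euc d) :=
  v '' T ∪ (fun a => -v a) '' T

variable {v : ι → Euc d} {T : Finset ι} {δ : ℝ}

theorem neg_mem_symmetrization {x : Euc d} (hx : x ∈ symmetrization v T) :
    -x ∈ symmetrization v T := by
  rcases hx with ⟨a, ha, rfl⟩ | ⟨a, ha, rfl⟩
  · exact Or.inr ⟨a, ha, rfl⟩
  · exact Or.inl ⟨a, ha, (neg_neg _).symm⟩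

theorem finite_symmetrization : (symmetrization v T).Finite :=
  (T.finite_toSet.image _).union (T.finite_toSet.image _)

theorem ncard_symmetrization (hunit : ∀ a ∈ T, inner ℝ (v a) (v a) = (1 : ℝ))
    (hsep : ∀ a ∈ T, ∀ b ∈ T, a ≠ b → |(inner ℝ (v a) (v b) : ℝ)| < 1) :
    (symmetrization v T).ncard = 2 * T.card := by
  have hinj : Set.InjOn v T := by
    intro a ha b hb hab
    by_contra hne
    have h := hsep a ha b hb hne
    rw [← hab, hunit a ha, abs_one] at h
    exact lt_irrefl _ h
  have hinj' : Set.InjOn (fun a => -v a) T := fun a ha b hb hab => hinj ha hb (neg_injective hab)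
  have hdisj : Disjoint (v '' T) ((fun a => -v a) '' T) := by
    rw [Set.disjoint_left]
    rintro _ ⟨a, ha, rfl⟩ ⟨b, hb, hab⟩
    have hab' : -v b = v a := hab
    by_cases hne : a = b
    · subst hne
      have h := hunit a ha
      nth_rewrite 2 [← hab'] at h
      rw [inner_neg_right, hunit a ha] at h
      norm_num at h
    · have h := hsep a ha b hb hne
      rw [← hab', inner_neg_left, hunit b hb] at h
      norm_num at h
  rw [symmetrization, Set.ncard_union_eq hdisj (T.finite_toSet.image _) (T.finite_toSet.image _),
    hinj.ncard_image, hinj'.ncard_image, Set.ncard_coe_finset, two_mul]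

theorem le_sepS_symmetrization (hT : T.Nonempty) (hδ0 : 0 ≤ δ) (hδ : δ ≤ π)
    (hunit : ∀ a ∈ T, inner ℝ (v a) (v a) = (1 : ℝ))
    (hsep : ∀ a ∈ T, ∀ b ∈ T, a ≠ b → |(inner ℝ (v a) (v b) : ℝ)| ≤ Real.cos δ) :
    δ ≤ sepS (symmetrization v T) := by
  refine le_csInf ?_ ?_
  · obtain ⟨a, ha⟩ := hT
    refine ⟨_, v a, Or.inl ⟨a, ha, rfl⟩, -v a, Or.inr ⟨a, ha, rfl⟩, ?_, rfl⟩
    intro h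
    have h1 := hunit a ha
    nth_rewrite 2 [h] at h1
    rw [inner_neg_right, hunit a ha] at h1
    norm_num at h1
  · rintro _ ⟨p, hp, q, hq, hne, rfl⟩
    rw [← Real.arccos_cos hδ0 hδ]
    apply Real.antitone_arccos
    have hcos := Real.neg_one_le_cos δ
    rcases hp with ⟨a, ha, rfl⟩ | ⟨a, ha, rfl⟩ <;> rcases hq with ⟨b, hb, rfl⟩ | ⟨b, hb, rfl⟩ <;>
      by_cases hab : a = b
    · exact absurd (congrArg v hab) hne
    · exact (abs_le.1 (hsep a ha b hb hab)).2
    · subst hab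
      rwa [inner_neg_right, hunit a ha]
    · rw [inner_neg_right]
      linarith [(abs_le.1 (hsep a ha b hb hab)).1]
    · subst hab
      rwa [inner_neg_left, hunit a ha]
    · rw [inner_neg_left]
      linarith [(abs_le.1 (hsep a ha b hb hab)).1]
    · exact absurd (congrArg (fun a => -v a) hab) hne
    · rw [inner_neg_neg]
      exact (abs_le.1 (hsep a ha b hb hab)).2

end Separation

section Configuration

variable {d : ℕ}

/-- The orientation sign of an ordered pair of coordinates. -/
def pairSign (i l : Fin d) : ℝ := if i < l then 1 else -1

/-- The point at angle `θ` from `e_i` on the arc from `e_i` to `± e_l`. -/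
def arcPoint (i l : Fin d) (θ : ℝ) : Euc d :=
  Real.cos θ • EuclideanSpace.single i (1 : ℝ) +
    (pairSign i l * Real.sin θ) • EuclideanSpace.single l (1 : ℝ)

theorem pairSign_mul_self (i l : Fin d) : pairSign i l * pairSign i l = 1 := by
  unfold pairSign; split_ifs <;> norm_num

theorem abs_pairSign (i l : Fin d) : |pairSign i l| = 1 := by
  unfold pairSign; split_ifs <;> norm_num

theorem pairSign_swap {i l : Fin d} (h : i ≠ l) : pairSign l i = -pairSign i l := by
  unfold pairSign
  rcases lt_or_gt_of_ne h with h | h <;> simp [h, h.not_gt]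

theorem arcPoint_zero (i l : Fin d) : arcPoint i l 0 = EuclideanSpace.single i 1 := by
  simp [arcPoint]

theorem inner_arcPoint (i l i' l' : Fin d) (θ θ' : ℝ) :
    (inner ℝ (arcPoint i l θ) (arcPoint i' l' θ') : ℝ) =
      (if i = i' then Real.cos θ * Real.cos θ' else 0) +
      (if i = l' then Real.cos θ * (pairSign i' l' * Real.sin θ') else 0) +
      ((if l = i' then pairSign i l * Real.sin θ * Real.cos θ' else 0) +
      (if l = l' then pairSign i l * Real.sin θ * (pairSign i' l' * Real.sin θ') else 0)) := by
  simp only [arcPoint, inner_add_left, inner_add_right, real_inner_smul_left,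
    real_inner_smul_right, EuclideanSpace.inner_single_left, PiLp.single_apply]
  simp only [map_one, mul_ite, mul_one, mul_zero]
  split_ifs <;> ring

theorem inner_arcPoint_self {i l : Fin d} {θ : ℝ} (h : i ≠ l ∨ θ = 0) :
    (inner ℝ (arcPoint i l θ) (arcPoint i l θ) : ℝ) = 1 := by
  rcases h with h | rfl
  · rw [inner_arcPoint]
    simp only [h, h.symm, if_true, if_false]
    linear_combination Real.cos_sq_add_sin_sq θ + Real.sin θ ^ 2 * pairSign_mul_self i l
  · rw [arcPoint_zero]
    simp

theorem abs_mul_le_of_nonneg {a b c : ℝ} (ha : 0 ≤ a) (hac : a ≤ c) (hb : |b| ≤ 1) :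
    |a * b| ≤ c := by
  rw [abs_mul, abs_of_nonneg ha]
  nlinarith [abs_nonneg b]

/-- Points on distinct arcs, or well separated on one arc, have small inner product. -/
theorem abs_inner_arcPoint_le {i l i' l' : Fin d} {θ θ' δ : ℝ} (hδ : 0 ≤ δ)
    (hil : i ≠ l) (hil' : i' ≠ l')
    (hθ : δ ≤ θ) (hθ2 : θ ≤ π / 2 - δ) (hθ' : δ ≤ θ') (hθ2' : θ' ≤ π / 2 - δ)
    (hne : (i = i' ∧ l = l') → δ ≤ |θ - θ'|) :
    |(inner ℝ (arcPoint i l θ) (arcPoint i' l' θ') : ℝ)| ≤ Real.cos δ := by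
  have hpi := pi_pos
  have hcosδ : 0 ≤ Real.cos δ := Real.cos_nonneg_of_mem_Icc ⟨by linarith, by linarith⟩
  have hcos : 0 ≤ Real.cos θ := Real.cos_nonneg_of_mem_Icc ⟨by linarith, by linarith⟩
  have hcosle : Real.cos θ ≤ Real.cos δ :=
    Real.cos_le_cos_of_nonneg_of_le_pi hδ (by linarith) hθ
  have hsin : 0 ≤ Real.sin θ := Real.sin_nonneg_of_nonneg_of_le_pi (by linarith) (by linarith)
  have hsinle : Real.sin θ ≤ Real.cos δ := by
    rw [← Real.sin_pi_div_two_sub]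
    exact Real.sin_le_sin_of_le_of_le_pi_div_two (by linarith) (by linarith) hθ2
  rw [inner_arcPoint]
  by_cases h1 : i = i'
  · subst h1
    by_cases h2 : l = l'
    · subst h2
      simp only [hil, hil.symm, if_true, if_false]
      have e : Real.cos θ * Real.cos θ' + 0 +
          (0 + pairSign i l * Real.sin θ * (pairSign i l * Real.sin θ')) = Real.cos |θ - θ'| := by
        rw [Real.cos_abs, Real.cos_sub]
        linear_combination Real.sin θ * Real.sin θ' * pairSign_mul_self i l
      have hub : |θ - θ'| ≤ π / 2 := abs_le.2 ⟨by linarith, by linarith⟩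
      rw [e, abs_of_nonneg (Real.cos_nonneg_of_mem_Icc ⟨by linarith [abs_nonneg (θ - θ')], hub⟩)]
      exact Real.cos_le_cos_of_nonneg_of_le_pi hδ (by linarith) (hne ⟨rfl, rfl⟩)
    · simp only [hil.symm, hil', h2, if_true, if_false, add_zero]
      exact abs_mul_le_of_nonneg hcos hcosle (Real.abs_cos_le_one _)
  · by_cases h2 : i = l'
    · subst h2
      by_cases h3 : l = i'
      · subst h3
        simp only [hil, hil.symm, if_true, if_false]
        have e : 0 + Real.cos θ * (pairSign l i * Real.sin θ') +
            (pairSign i l * Real.sin θ * Real.cos θ' + 0) = pairSign i l * Real.sin (θ - θ') := by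
          rw [pairSign_swap hil, Real.sin_sub]
          ring
        rw [e, abs_mul, abs_pairSign, one_mul, ← Real.sin_pi_div_two_sub]
        refine abs_le.2 ⟨?_, ?_⟩
        · rw [← Real.sin_neg]
          exact Real.sin_le_sin_of_le_of_le_pi_div_two (by linarith) (by linarith) (by linarith)
        · exact Real.sin_le_sin_of_le_of_le_pi_div_two (by linarith) (by linarith) (by linarith)
      · simp only [h1, hil.symm, h3, if_true, if_false, add_zero, zero_add]
        refine abs_mul_le_of_nonneg hcos hcosle ?_
        rw [abs_mul, abs_pairSign, one_mul]
        exact Real.abs_sin_le_one _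
    · by_cases h3 : l = i'
      · subst h3
        simp only [h1, h2, hil', if_true, if_false, add_zero, zero_add]
        rw [mul_assoc, abs_mul, abs_pairSign, one_mul]
        exact abs_mul_le_of_nonneg hsin hsinle (Real.abs_cos_le_one _)
      · by_cases h4 : l = l'
        · subst h4
          simp only [h1, h2, h3, if_true, if_false, zero_add]
          rw [mul_assoc, abs_mul, abs_pairSign, one_mul]
          refine abs_mul_le_of_nonneg hsin hsinle ?_
          rw [abs_mul, abs_pairSign, one_mul]
          exact Real.abs_sin_le_one _
        · simpa [h1, h2, h3, h4] using hcosδ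

theorem abs_inner_single_arcPoint_le {a i l : Fin d} {θ δ : ℝ} (hδ : 0 ≤ δ) (hil : i ≠ l)
    (hθ : δ ≤ θ) (hθ2 : θ ≤ π / 2 - δ) :
    |(inner ℝ (EuclideanSpace.single a 1) (arcPoint i l θ) : ℝ)| ≤ Real.cos δ := by
  have hpi := pi_pos
  have hcosδ : 0 ≤ Real.cos δ := Real.cos_nonneg_of_mem_Icc ⟨by linarith, by linarith⟩
  rw [← arcPoint_zero a a, inner_arcPoint]
  simp only [Real.cos_zero, Real.sin_zero, one_mul, mul_zero, zero_mul, ite_self, add_zero]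
  by_cases h1 : a = i
  · subst h1
    simp only [hil, if_true, if_false, add_zero]
    rw [abs_of_nonneg (Real.cos_nonneg_of_mem_Icc ⟨by linarith, by linarith⟩)]
    exact Real.cos_le_cos_of_nonneg_of_le_pi hδ (by linarith) hθ
  · by_cases h2 : a = l
    · simp only [h2, hil.symm, if_true, if_false, zero_add]
      rw [abs_mul, abs_pairSign, one_mul,
        abs_of_nonneg (Real.sin_nonneg_of_nonneg_of_le_pi (by linarith) (by linarith)),
        ← Real.sin_pi_div_two_sub]
      exact Real.sin_le_sin_of_le_of_le_pi_div_two (by linarith) (by linarith) hθ2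
    · simpa [h1, h2] using hcosδ

/-- Labels of the vertices `e_i` of the cross-polytope, one from each antipodal pair. -/
def vertexLabels (d : ℕ) : Finset ((Fin d × Fin d) × ℕ) :=
  Finset.univ.diag ×ˢ {0}

/-- Labels of `m` points on each edge of the cross-polytope, one from each antipodal pair. -/
def edgeLabels (d m : ℕ) : Finset ((Fin d × Fin d) × ℕ) :=
  Finset.univ.offDiag ×ˢ Finset.Icc 1 m

theorem card_vertexLabels : (vertexLabels d).card = d := by
  simp [vertexLabels]

theorem disjoint_labels (m : ℕ) : Disjoint (vertexLabels d) (edgeLabels d m) := by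
  rw [Finset.disjoint_left]
  rintro ⟨⟨i, l⟩, j⟩ h h'
  simp only [vertexLabels, edgeLabels, Finset.mem_product, Finset.mem_diag, Finset.mem_offDiag]
    at h h'
  exact h'.1.2.2 h.1.2

theorem card_labels (m : ℕ) :
    (vertexLabels d ∪ edgeLabels d m).card = d + (d * d - d) * m := by
  rw [Finset.card_union_of_disjoint (disjoint_labels m), card_vertexLabels]
  simp [edgeLabels, Finset.offDiag_card]

/-- The point with a given label, for subdivision step `δ`. -/
def labelPoint (δ : ℝ) (a : (Fin d × Fin d) × ℕ) : Euc d := arcPoint a.1.1 a.1.2 (a.2 * δ)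

variable {m : ℕ} {a b : (Fin d × Fin d) × ℕ}

theorem inner_labelPoint_self (δ : ℝ) (ha : a ∈ vertexLabels d ∪ edgeLabels d m) :
    (inner ℝ (labelPoint δ a) (labelPoint δ a) : ℝ) = 1 := by
  obtain ⟨⟨i, l⟩, j⟩ := a
  simp only [vertexLabels, edgeLabels, Finset.mem_union, Finset.mem_product, Finset.mem_diag,
    Finset.mem_offDiag, Finset.mem_singleton] at ha
  refine inner_arcPoint_self (ha.symm.imp (fun h => h.1.2.2) fun h => ?_)
  simp [h.2]

theorem abs_inner_labelPoint_le (ha : a ∈ vertexLabels d ∪ edgeLabels d m)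
    (hb : b ∈ vertexLabels d ∪ edgeLabels d m) (hab : a ≠ b) :
    |(inner ℝ (labelPoint (π / (2 * ((m : ℝ) + 1))) a)
      (labelPoint (π / (2 * ((m : ℝ) + 1))) b) : ℝ)| ≤ Real.cos (π / (2 * ((m : ℝ) + 1))) := by
  have hpi := pi_pos
  set δ := π / (2 * ((m : ℝ) + 1)) with hδdef
  have hδ : 0 ≤ δ := by positivity
  have hmδ : ((m : ℝ) + 1) * δ = π / 2 := by rw [hδdef]; field_simp
  have hδle : δ ≤ π / 2 := by nlinarith [mul_nonneg (Nat.cast_nonneg (α := ℝ) m) hδ]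
  have hrange : ∀ j : ℕ, 1 ≤ j ∧ j ≤ m → δ ≤ j * δ ∧ j * δ ≤ π / 2 - δ := by
    rintro j ⟨h1, h2⟩
    have h1' : (1 : ℝ) ≤ j := by exact_mod_cast h1
    have h2' : (j : ℝ) ≤ m := by exact_mod_cast h2
    constructor <;> nlinarith
  obtain ⟨⟨i, l⟩, j⟩ := a
  obtain ⟨⟨i', l'⟩, j'⟩ := b
  simp only [vertexLabels, edgeLabels, Finset.mem_union, Finset.mem_product, Finset.mem_diag,
    Finset.mem_offDiag, Finset.mem_singleton, Finset.mem_univ, true_and, Finset.mem_Icc] at ha hb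
  simp only [labelPoint]
  rcases ha with ⟨rfl, rfl⟩ | ⟨hil, hj⟩ <;> rcases hb with ⟨rfl, rfl⟩ | ⟨hil', hj'⟩
  · have hii : i ≠ i' := fun h => hab (by rw [h])
    simp only [Nat.cast_zero, zero_mul, arcPoint_zero]
    have hcos : 0 ≤ Real.cos δ := Real.cos_nonneg_of_mem_Icc ⟨by linarith, hδle⟩
    simpa [EuclideanSpace.inner_single_left, hii] using hcos
  · simp only [Nat.cast_zero, zero_mul, arcPoint_zero]
    exact abs_inner_single_arcPoint_le hδ hil' (hrange j' hj').1 (hrange j' hj').2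
  · simp only [Nat.cast_zero, zero_mul, arcPoint_zero]
    rw [real_inner_comm]
    exact abs_inner_single_arcPoint_le hδ hil (hrange j hj).1 (hrange j hj).2
  · refine abs_inner_arcPoint_le hδ hil hil' (hrange j hj).1 (hrange j hj).2 (hrange j' hj').1
      (hrange j' hj').2 ?_
    rintro ⟨rfl, rfl⟩
    have hjj : (j : ℤ) - j' ≠ 0 := fun h => hab (by rw [show j = j' by omega])
    have h1 : (1 : ℝ) ≤ |(j : ℝ) - j'| := by exact_mod_cast Int.one_le_abs hjj
    rw [← sub_mul, abs_mul, abs_of_nonneg hδ]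
    nlinarith

end Configuration

/-- For all 2 ≤ n < k < ∞, there exists an antipodal set P ⊆ S^n of 2(k+1) points with
vdiam(P) ≤ πn/(n+1) and sep(P) ≥ π/(2(⌈(k−n)/(n(n+1))⌉+1)) ≥ π/(k−n+3). -/
theorem exists_antipodal_set (n k : ℕ) (hn : 2 ≤ n) (hnk : n < k) :
    ∃ P : Set (Euc (n+1)), P ⊆ usphere n ∧ (∀ x ∈ P, -x ∈ P) ∧
      P.Finite ∧ P.ncard = 2 * (k + 1) ∧
      vdiam (usphere n) P ≤ π * n / ((n : ℝ) + 1) ∧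
      π / (2 * ((⌈((k : ℝ) - n) / ((n : ℝ) * ((n : ℝ) + 1))⌉ : ℝ) + 1)) ≤ sepS P ∧
      π / ((k : ℝ) - (n : ℝ) + 3) ≤
        π / (2 * ((⌈((k : ℝ) - n) / ((n : ℝ) * ((n : ℝ) + 1))⌉ : ℝ) + 1)) := by 
  have hn0 : (2 : ℝ) ≤ n := by exact_mod_cast hn
  have hnk' : (n : ℝ) + 1 ≤ k := by exact_mod_cast hnk
  have hD : (0 : ℝ) < (n : ℝ) * ((n : ℝ) + 1) := by positivity
  set r : ℝ := ((k : ℝ) - n) / ((n : ℝ) * ((n : ℝ) + 1)) with hr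
  have hr0 : 0 < r := div_pos (by linarith) hD
  rw [← natCast_ceil_eq_intCast_ceil hr0.le]
  set m := ⌈r⌉₊ with hm
  have hm1 : 1 ≤ m := Nat.ceil_pos.2 hr0
  have hm1' : (1 : ℝ) ≤ m := by exact_mod_cast hm1
  have hle : k - n ≤ n * (n + 1) * m := by
    have h := (div_le_iff₀ hD).1 (Nat.le_ceil r)
    have h' : (k : ℝ) ≤ n * (n + 1) * m + n := by linarith
    have h'' : k ≤ n * (n + 1) * m + n := by exact_mod_cast h'
    omega
  have hmle : 2 * ((m : ℝ) + 1) ≤ (k : ℝ) - n + 3 := by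
    by_cases h1 : m = 1
    · rw [h1]
      push_cast
      linarith
    · have h2 : (2 : ℝ) ≤ m := by exact_mod_cast (show 2 ≤ m by omega)
      have h3 : (m : ℝ) < r + 1 := Nat.ceil_lt_add_one hr0.le
      have h4 : 6 * r ≤ (k : ℝ) - n := by
        have : r * ((n : ℝ) * ((n : ℝ) + 1)) = (k : ℝ) - n := div_mul_cancel₀ _ hD.ne'
        have h6 : (6 : ℝ) ≤ (n : ℝ) * ((n : ℝ) + 1) := by nlinarith
        nlinarith
      linarith
  set δ := π / (2 * ((m : ℝ) + 1)) with hδ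
  have hδ0 : 0 < δ := by positivity
  have hδπ : δ ≤ π := div_le_self pi_pos.le (by linarith)
  have hcos : Real.cos δ < 1 := by
    rw [← Real.cos_zero]
    exact Real.cos_lt_cos_of_nonneg_of_le_pi le_rfl hδπ hδ0
  obtain ⟨T, hT1, hT2, hTcard⟩ := Finset.exists_subsuperset_card_eq
    (s := vertexLabels (n + 1)) (t := vertexLabels (n + 1) ∪ edgeLabels (n + 1) m) (n := k + 1)
    Finset.subset_union_left (by rw [card_vertexLabels]; omega) (by
      rw [card_labels, show (n + 1) * (n + 1) - (n + 1) = n * (n + 1) by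
        rw [← Nat.sub_one_mul]; rfl]
      omega)
  have hunit : ∀ a ∈ T, (inner ℝ (labelPoint δ a) (labelPoint δ a) : ℝ) = 1 := fun a ha =>
    inner_labelPoint_self δ (hT2 ha)
  have hsep : ∀ a ∈ T, ∀ b ∈ T, a ≠ b →
      |(inner ℝ (labelPoint δ a) (labelPoint δ b) : ℝ)| ≤ Real.cos δ := fun a ha b hb hab =>
    abs_inner_labelPoint_le (hT2 ha) (hT2 hb) hab
  have hsub : symmetrization (labelPoint δ) T ⊆ usphere n := by
    rintro _ (⟨a, ha, rfl⟩ | ⟨a, ha, rfl⟩)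
    · exact hunit a ha
    · exact (inner_neg_neg _ _).trans (hunit a ha)
  refine ⟨symmetrization (labelPoint δ) T, hsub, fun x hx => neg_mem_symmetrization hx,
    finite_symmetrization, ?_, ?_, ?_, ?_⟩
  · rw [ncard_symmetrization hunit fun a ha b hb hab => (hsep a ha b hb hab).trans_lt hcos, hTcard]
  · refine vdiam_le_of_single_mem hn hsub (fun x hx => neg_mem_symmetrization hx) fun i => ?_
    exact Or.inl ⟨((i, i), 0), hT1 (by simp [vertexLabels]), by simp [labelPoint, arcPoint_zero]⟩
  · exact le_sepS_symmetrization (Finset.card_pos.1 (by omega)) hδ0.le hδπ hunit hsep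
  · exact div_le_div_of_nonneg_left pi_pos.le (by linarith) hmle
end
end

section
/- For all integers 1 ≤ n < k < ∞, the Gromov–Hausdorff distance between S^n and S^k, each equipped with the Euclidean (chordal) metric induced from ℝ^{n+1} and ℝ^{k+1} respectively, satisfies d_GH(S^n_E, S^k_E) ≤ sin(πk/(2(k+1))). -/
open Real

noncomputable section

instance sphereNonempty (d : ℕ) : Nonempty (Metric.sphere (0 : Euc (d+1)) 1) :=
  (NormedSpace.sphere_nonempty.mpr zero_le_one).to_subtype

open InnerProductGeometry Set

/-- A correspondence between compact metric spaces whose distortion is at most `2 * c` bounds the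
Gromov–Hausdorff distance by `c`. -/
theorem ghDist_le_of_correspondence {X Y : Type*} [MetricSpace X] [CompactSpace X] [Nonempty X]
    [MetricSpace Y] [CompactSpace Y] [Nonempty Y] (R : X → Y → Prop) {c : ℝ} (hc : 0 < c)
    (hX : ∀ x, ∃ y, R x y) (hY : ∀ y, ∃ x, R x y)
    (hR : ∀ x y x' y', R x y → R x' y' → |dist x x' - dist y y'| ≤ 2 * c) :
    GromovHausdorff.ghDist X Y ≤ c := by
  let Z := {z : X × Y // R z.1 z.2}
  obtain ⟨x₀⟩ := ‹Nonempty X›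
  obtain ⟨y₀, h₀⟩ := hX x₀
  have : Nonempty Z := ⟨⟨(x₀, y₀), h₀⟩⟩
  let Φ : Z → X := fun z => z.1.1
  let Ψ : Z → Y := fun z => z.1.2
  have H : ∀ p q : Z, |dist (Φ p) (Φ q) - dist (Ψ p) (Ψ q)| ≤ 2 * c :=
    fun p q => hR _ _ _ _ p.2 q.2
  let _ : MetricSpace (X ⊕ Y) := Metric.glueMetricApprox Φ Ψ c hc H
  have hl : Isometry (Sum.inl : X → X ⊕ Y) := Isometry.of_dist_eq fun _ _ => rfl
  have hr : Isometry (Sum.inr : Y → X ⊕ Y) := Isometry.of_dist_eq fun _ _ => rfl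
  have hglue : ∀ z : Z, dist (Sum.inl (Φ z) : X ⊕ Y) (Sum.inr (Ψ z)) = c :=
    fun z => Metric.glueDist_glued_points Φ Ψ c z
  refine (GromovHausdorff.ghDist_le_hausdorffDist hl hr).trans
    (Metric.hausdorffDist_le_of_mem_dist hc.le ?_ ?_)
  · rintro _ ⟨x, rfl⟩
    obtain ⟨y, hxy⟩ := hX x
    exact ⟨_, ⟨y, rfl⟩, (hglue ⟨(x, y), hxy⟩).le⟩
  · rintro _ ⟨y, rfl⟩
    obtain ⟨x, hxy⟩ := hY y
    exact ⟨_, ⟨x, rfl⟩, (dist_comm _ _).trans_le (hglue ⟨(x, y), hxy⟩).le⟩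

section SphericalFrame

variable {ι V W : Type*} [NormedAddCommGroup V] [InnerProductSpace ℝ V]
  [NormedAddCommGroup W] [InnerProductSpace ℝ W] {p : ι → V} {q : ι → W} {ε : ℝ}

/-- Unit vectors spanning lines which pairwise make an angle at least `ε`, such that each unit
vector is at angle at most `π / 2 - ε / 2` from one of these lines. -/
structure IsSphericalFrame (p : ι → V) (ε : ℝ) : Prop where
  norm_eq_one : ∀ i, ‖p i‖ = 1
  le_angle : ∀ i j, i ≠ j → ε ≤ angle (p i) (p j)
  angle_le : ∀ i j, i ≠ j → angle (p i) (p j) ≤ π - ε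
  exists_le_abs_inner : ∀ y : V, ‖y‖ = 1 → ∃ i, sin (ε / 2) ≤ |inner ℝ (p i) y|

/-- The unit vectors for which `p i` is the closest among all the vectors `p j` and `-p j`. -/
def voronoiCell (p : ι → V) (i : ι) : Set V :=
  {y | ‖y‖ = 1 ∧ ∀ j, |inner ℝ (p j) y| ≤ inner ℝ (p i) y}

theorem cos_angle_of_norm_eq_one {x y : V} (hx : ‖x‖ = 1) (hy : ‖y‖ = 1) :
    cos (angle x y) = inner ℝ x y := by
  rw [cos_angle, hx, hy, mul_one, div_one]

theorem dist_eq_two_mul_sin_half_angle {x y : V} (hx : ‖x‖ = 1) (hy : ‖y‖ = 1) :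
    dist x y = 2 * sin (angle x y / 2) := by
  have hs : 0 ≤ sin (angle x y / 2) :=
    sin_nonneg_of_nonneg_of_le_pi (by linarith [angle_nonneg x y])
      (by linarith [angle_le_pi x y, pi_pos])
  refine (sq_eq_sq₀ dist_nonneg (by positivity)).1 ?_
  have h := cos_angle_of_norm_eq_one hx hy
  have hc : cos (angle x y) = 1 - 2 * sin (angle x y / 2) ^ 2 := by
    rw [sin_sq, ← mul_div_cancel₀ (angle x y) (two_ne_zero' ℝ), cos_two_mul]
    simp only [mul_div_cancel_left₀ _ (two_ne_zero' ℝ)]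
    ring
  rw [hc] at h
  rw [dist_eq_norm, norm_sub_sq_real, hx, hy, ← h]
  ring

/-- A bound on a difference of angles gives a bound on the difference of the chords. -/
theorem dist_sub_dist_le_of_angle_sub_angle_le {x x' : V} {y y' : W} (hx : ‖x‖ = 1)
    (hx' : ‖x'‖ = 1) (hy : ‖y‖ = 1) (hy' : ‖y'‖ = 1) (hε : 0 ≤ ε) (hε' : ε ≤ π)
    (h : angle x x' - angle y y' ≤ π - ε) : dist x x' - dist y y' ≤ 2 * cos (ε / 2) := by
  rw [dist_eq_two_mul_sin_half_angle hx hx', dist_eq_two_mul_sin_half_angle hy hy', ← mul_sub,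
    sin_sub_sin]
  have hcos : 0 ≤ cos (ε / 2) := cos_nonneg_of_mem_Icc ⟨by linarith, by linarith⟩
  have ha := angle_nonneg x x'
  have ha' := angle_le_pi x x'
  have hb := angle_nonneg y y'
  have hb' := angle_le_pi y y'
  set a := angle x x'
  set b := angle y y'
  have hc : 0 ≤ cos ((a / 2 + b / 2) / 2) := cos_nonneg_of_mem_Icc ⟨by linarith, by linarith⟩
  rcases le_total a b with hab | hab
  · have : sin ((a / 2 - b / 2) / 2) ≤ 0 :=
      sin_nonpos_of_nonpos_of_neg_pi_le (by linarith) (by linarith)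
    nlinarith
  · have hs : 0 ≤ sin ((a / 2 - b / 2) / 2) :=
      sin_nonneg_of_nonneg_of_le_pi (by linarith) (by linarith)
    have hle : cos ((a / 2 + b / 2) / 2) ≤ cos ((a / 2 - b / 2) / 2) :=
      cos_le_cos_of_nonneg_of_le_pi (by linarith) (by linarith) (by linarith)
    have hd : 2 * sin ((a / 2 - b / 2) / 2) * cos ((a / 2 - b / 2) / 2) = sin (a / 2 - b / 2) := by
      rw [← sin_two_mul]
      congr 1
      ring
    have hle' : sin (a / 2 - b / 2) ≤ cos (ε / 2) := by
      rw [← sin_pi_div_two_sub]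
      exact sin_le_sin_of_le_of_le_pi_div_two (by linarith) (by linarith) (by linarith)
    nlinarith [mul_le_mul_of_nonneg_left hle hs]

theorem angle_le_pi_div_two_of_mem_voronoiCell {i : ι} {y : V}
    (hy : y ∈ voronoiCell p i) : angle (p i) y ≤ π / 2 :=
  arccos_le_pi_div_two.2 (div_nonneg ((abs_nonneg _).trans (hy.2 i)) (by positivity))

namespace IsSphericalFrame

theorem angle_le_of_mem (hp : IsSphericalFrame p ε) (hε : 0 ≤ ε) (hε' : ε ≤ π / 2) {i : ι}
    {y : V} (hy : y ∈ voronoiCell p i) : angle (p i) y ≤ π / 2 - ε / 2 := by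
  obtain ⟨j, hj⟩ := hp.exists_le_abs_inner y hy.1
  refine (strictAntiOn_cos.le_iff_ge ⟨by linarith, by linarith [pi_pos]⟩
    ⟨angle_nonneg _ _, angle_le_pi _ _⟩).1 ?_
  rw [cos_pi_div_two_sub, cos_angle_of_norm_eq_one (hp.norm_eq_one i) hy.1]
  exact hj.trans (hy.2 j)

theorem angle_le_of_mem_of_mem (hp : IsSphericalFrame p ε) (hε : 0 ≤ ε) (hε' : ε ≤ π / 2)
    {i : ι} {y y' : V} (hy : y ∈ voronoiCell p i) (hy' : y' ∈ voronoiCell p i) :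
    angle y y' ≤ π - ε := by
  have h := angle_le_angle_add_angle y (p i) y'
  rw [angle_comm y (p i)] at h
  linarith [hp.angle_le_of_mem hε hε' hy, hp.angle_le_of_mem hε hε' hy']

theorem angle_mem_Icc_of_mem (hp : IsSphericalFrame p ε) {i j : ι} (hij : i ≠ j) {y : V}
    (hy : y ∈ voronoiCell p j) : angle (p i) y ∈ Icc (ε / 2) (π - ε / 2) := by
  have hcomp : ∀ v : V, ‖v‖ = 1 → inner ℝ v y ≤ inner ℝ (p j) y → angle (p j) y ≤ angle v y := by
    intro v hv h
    rw [← cos_angle_of_norm_eq_one hv hy.1,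
      ← cos_angle_of_norm_eq_one (hp.norm_eq_one j) hy.1] at h
    exact (strictAntiOn_cos.le_iff_ge ⟨angle_nonneg _ _, angle_le_pi _ _⟩
      ⟨angle_nonneg _ _, angle_le_pi _ _⟩).1 h
  have hpi := hp.norm_eq_one i
  have h1 := hcomp (p i) hpi ((le_abs_self _).trans (hy.2 i))
  have h2 := hcomp (-p i) (by rwa [norm_neg])
    (by rw [inner_neg_left]; exact (neg_le_abs _).trans (hy.2 i))
  have h3 := angle_le_angle_add_angle (p i) y (p j)
  have h4 := angle_le_angle_add_angle (-p i) y (p j)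
  rw [angle_comm y (p j)] at h3 h4
  rw [angle_neg_left] at h2 h4
  rw [angle_neg_left] at h4
  constructor
  · linarith [hp.le_angle i j hij]
  · linarith [hp.angle_le i j hij]

theorem exists_mem_voronoiCell [Finite ι] (hp : IsSphericalFrame p ε) {y : V} (hy : ‖y‖ = 1) :
    ∃ i, y ∈ voronoiCell p i ∨ -y ∈ voronoiCell p i := by
  have : Nonempty ι := ⟨(hp.exists_le_abs_inner y hy).choose⟩
  obtain ⟨i, hi⟩ := Finite.exists_max fun i => |inner ℝ (p i) y|
  refine ⟨i, ?_⟩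
  rcases abs_choice (inner ℝ (p i) y) with h | h
  · exact .inl ⟨hy, fun j => (hi j).trans h.le⟩
  · refine .inr ⟨by rwa [norm_neg], fun j => ?_⟩
    rw [inner_neg_right, inner_neg_right, abs_neg]
    exact (hi j).trans h.le

end IsSphericalFrame

/-- The relation matching the vectors of each frame with the Voronoi cells of the other frame. -/
def cellMatching (p : ι → V) (q : ι → W) (y : V) (x : W) : Prop :=
  ∃ i, (y = p i ∧ x ∈ voronoiCell q i) ∨ (y ∈ voronoiCell p i ∧ x = q i)

theorem cellMatching.swap {y : V} {x : W} (h : cellMatching p q y x) : cellMatching q p x y := by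
  obtain ⟨i, h | h⟩ := h
  exacts [⟨i, .inr h.symm⟩, ⟨i, .inl h.symm⟩]

theorem cellMatching.angle_sub_le (hp : IsSphericalFrame p ε) (hq : IsSphericalFrame q ε)
    (hε : 0 ≤ ε) (hε' : ε ≤ π / 2) {y y' : V} {x x' : W} (h : cellMatching p q y x)
    (h' : cellMatching p q y' x') : angle y y' - angle x x' ≤ π - ε := by
  have hx := angle_nonneg x x'
  obtain ⟨i, ⟨rfl, hi⟩ | ⟨hi, rfl⟩⟩ := h <;> obtain ⟨j, ⟨rfl, hj⟩ | ⟨hj, rfl⟩⟩ := h'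
  · rcases eq_or_ne i j with rfl | hij
    · rw [angle_self (by rw [← norm_ne_zero_iff, hp.norm_eq_one]; exact one_ne_zero)]
      linarith
    · linarith [hp.angle_le i j hij]
  · rcases eq_or_ne i j with rfl | hij
    · linarith [angle_le_pi_div_two_of_mem_voronoiCell hj]
    · rw [angle_comm x]
      linarith [(hp.angle_mem_Icc_of_mem hij hj).2, (hq.angle_mem_Icc_of_mem hij.symm hi).1]
  · rcases eq_or_ne i j with rfl | hij
    · rw [angle_comm]
      linarith [angle_le_pi_div_two_of_mem_voronoiCell hi]
    · rw [angle_comm y]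
      linarith [(hp.angle_mem_Icc_of_mem hij.symm hi).2, (hq.angle_mem_Icc_of_mem hij hj).1]
  · rcases eq_or_ne i j with rfl | hij
    · linarith [hp.angle_le_of_mem_of_mem hε hε' hi hj]
    · linarith [hq.le_angle i j hij, angle_le_pi y y']

/-- The odd relation generated by `cellMatching`. -/
def oddCellMatching (p : ι → V) (q : ι → W) (y : V) (x : W) : Prop :=
  cellMatching p q y x ∨ cellMatching p q (-y) (-x)

theorem oddCellMatching.swap {y : V} {x : W} (h : oddCellMatching p q y x) :
    oddCellMatching q p x y :=
  h.imp cellMatching.swap cellMatching.swap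

theorem oddCellMatching.angle_sub_le (hp : IsSphericalFrame p ε) (hq : IsSphericalFrame q ε)
    (hε : 0 ≤ ε) (hε' : ε ≤ π / 2) {y y' : V} {x x' : W} (h : oddCellMatching p q y x)
    (h' : oddCellMatching p q y' x') : angle y y' - angle x x' ≤ π - ε := by
  rcases h with h | h <;> rcases h' with h' | h'
  · exact h.angle_sub_le hp hq hε hε' h'
  · have := h.swap.angle_sub_le hq hp hε hε' h'.swap
    rw [angle_neg_right, angle_neg_right] at this
    linarith
  · have := h.swap.angle_sub_le hq hp hε hε' h'.swap
    rw [angle_neg_left, angle_neg_left] at this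
    linarith
  · simpa only [angle_neg_neg] using h.angle_sub_le hp hq hε hε' h'

theorem oddCellMatching.exists_right [Finite ι] (hp : IsSphericalFrame p ε)
    (hq : IsSphericalFrame q ε) {y : V} (hy : ‖y‖ = 1) :
    ∃ x : W, ‖x‖ = 1 ∧ oddCellMatching p q y x := by
  obtain ⟨i, hi | hi⟩ := hp.exists_mem_voronoiCell hy
  · exact ⟨q i, hq.norm_eq_one i, .inl ⟨i, .inr ⟨hi, rfl⟩⟩⟩
  · exact ⟨-q i, by rw [norm_neg, hq.norm_eq_one], .inr ⟨i, .inr ⟨hi, neg_neg _⟩⟩⟩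

theorem ghDist_sphere_le_cos_of_isSphericalFrame [Finite ι] [ProperSpace V] [ProperSpace W]
    [Nonempty (Metric.sphere (0 : V) 1)] [Nonempty (Metric.sphere (0 : W) 1)]
    (hp : IsSphericalFrame p ε) (hq : IsSphericalFrame q ε) (hε : 0 ≤ ε) (hε' : ε ≤ π / 2) :
    GromovHausdorff.ghDist (Metric.sphere (0 : V) 1) (Metric.sphere (0 : W) 1) ≤
      cos (ε / 2) := by
  have hn : ∀ y : Metric.sphere (0 : V) 1, ‖(y : V)‖ = 1 := norm_eq_of_mem_sphere
  have hn' : ∀ x : Metric.sphere (0 : W) 1, ‖(x : W)‖ = 1 := norm_eq_of_mem_sphere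
  have hc : 0 < cos (ε / 2) := cos_pos_of_mem_Ioo ⟨by linarith [pi_pos], by linarith [pi_pos]⟩
  apply ghDist_le_of_correspondence (fun (y : Metric.sphere (0 : V) 1)
    (x : Metric.sphere (0 : W) 1) => oddCellMatching p q (y : V) (x : W)) hc
  rotate_left 2
  · intro y x y' x' h h'
    exact abs_sub_le_iff.2 ⟨dist_sub_dist_le_of_angle_sub_angle_le (hn y) (hn y') (hn' x) (hn' x')
      hε (by linarith) (h.angle_sub_le hp hq hε hε' h'),
      dist_sub_dist_le_of_angle_sub_angle_le (hn' x) (hn' x') (hn y) (hn y') hε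
        (by linarith) (h.swap.angle_sub_le hq hp hε hε' h'.swap)⟩
  · intro y
    obtain ⟨x, hx, h⟩ := oddCellMatching.exists_right hp hq (hn y)
    exact ⟨⟨x, mem_sphere_zero_iff_norm.2 hx⟩, h⟩
  · intro x
    obtain ⟨y, hy, h⟩ := oddCellMatching.exists_right hq hp (hn' x)
    exact ⟨⟨y, mem_sphere_zero_iff_norm.2 hy⟩, h.swap⟩

theorem IsSphericalFrame.of_abs_inner_le (hε : 0 ≤ ε) (hε' : ε ≤ π) (h1 : ∀ i, ‖p i‖ = 1)
    (hinner : ∀ i j, i ≠ j → |inner ℝ (p i) (p j)| ≤ cos ε)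
    (hcover : ∀ y : V, ‖y‖ = 1 → ∃ i, sin (ε / 2) ≤ |inner ℝ (p i) y|) :
    IsSphericalFrame p ε where
  norm_eq_one := h1
  exists_le_abs_inner := hcover
  le_angle i j hij := by
    refine (strictAntiOn_cos.le_iff_ge ⟨angle_nonneg _ _, angle_le_pi _ _⟩ ⟨hε, hε'⟩).1 ?_
    rw [cos_angle_of_norm_eq_one (h1 i) (h1 j)]
    exact (abs_le.1 (hinner i j hij)).2
  angle_le i j hij := by
    refine (strictAntiOn_cos.le_iff_ge ⟨by linarith, by linarith⟩
      ⟨angle_nonneg _ _, angle_le_pi _ _⟩).1 ?_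
    rw [cos_angle_of_norm_eq_one (h1 i) (h1 j), cos_pi_sub]
    exact (abs_le.1 (hinner i j hij)).1

theorem sin_pi_div_div_two_nonneg (m : ℕ) : 0 ≤ sin (π / m / 2) := by
  rcases Nat.eq_zero_or_pos m with rfl | hm
  · simp
  have : (1 : ℝ) ≤ m := by exact_mod_cast hm
  refine sin_nonneg_of_nonneg_of_le_pi (by positivity) ?_
  linarith [div_le_self pi_pos.le this, pi_pos]

theorem mul_sin_pi_div_div_two_sq_le_one {m : ℕ} (hm : 3 ≤ m) :
    m * sin (π / m / 2) ^ 2 ≤ 1 := by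
  have hm' : (3 : ℝ) ≤ m := by exact_mod_cast hm
  have h : sin (π / m / 2) ^ 2 ≤ (π / m / 2) ^ 2 :=
    pow_le_pow_left₀ (sin_pi_div_div_two_nonneg m) (sin_le (by positivity)) 2
  calc m * sin (π / m / 2) ^ 2 ≤ m * (π / m / 2) ^ 2 := by gcongr
    _ = π ^ 2 / (4 * m) := by field_simp; norm_num
    _ ≤ 1 := by
      rw [div_le_one (by positivity)]
      nlinarith [pi_lt_d2, pi_pos]

theorem OrthonormalBasis.isSphericalFrame [Fintype ι] (b : OrthonormalBasis ι ℝ V)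
    (hι : 3 ≤ Fintype.card ι) : IsSphericalFrame b (π / Fintype.card ι) := by
  have hι' : (3 : ℝ) ≤ Fintype.card ι := by exact_mod_cast hι
  have hle : π / Fintype.card ι ≤ π / 2 := by gcongr; linarith
  have hpos : 0 ≤ π / Fintype.card ι := by positivity
  refine .of_abs_inner_le hpos (by linarith [pi_pos]) b.norm_eq_one (fun i j hij => ?_)
    fun y hy => ?_
  · rw [b.inner_eq_zero hij, abs_zero]
    exact cos_nonneg_of_mem_Icc ⟨by linarith [pi_pos], hle⟩
  · by_contra! h
    have hsum := b.sum_sq_inner_right y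
    have hlt : ∑ i, inner ℝ (b i) y ^ 2 < ∑ _i : ι, sin (π / Fintype.card ι / 2) ^ 2 :=
      Finset.sum_lt_sum_of_nonempty
        (Finset.univ_nonempty_iff.2 (Fintype.card_pos_iff.1 (by omega)))
        fun i _ => sq_lt_sq' (by linarith [(abs_lt.1 (h i)).1]) (abs_lt.1 (h i)).2
    rw [hsum, hy, Finset.sum_const, Finset.card_univ, nsmul_eq_mul] at hlt
    linarith [mul_sin_pi_div_div_two_sq_le_one hι]

theorem sum_exp_two_mul_pi_mul_I_div_eq_zero {N : ℕ} (hN : 1 < N) :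
    ∑ i : Fin N, Complex.exp ((2 * (π * i / N) : ℝ) * Complex.I) = 0 := by
  have h := (Complex.isPrimitiveRoot_exp N (by omega)).geom_sum_eq_zero hN
  rw [← Fin.sum_univ_eq_sum_range (fun i => Complex.exp (2 * π * Complex.I / N) ^ i)] at h
  rw [← h]
  refine Finset.sum_congr rfl fun i _ => ?_
  rw [← Complex.exp_nat_mul]
  congr 1
  push_cast
  ring

theorem sum_cos_mul_add_sin_mul_sq {N : ℕ} (hN : 1 < N) (a b : ℝ) :
    ∑ i : Fin N, (cos (π * i / N) * a + sin (π * i / N) * b) ^ 2 = N / 2 * (a ^ 2 + b ^ 2) := by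
  have h := sum_exp_two_mul_pi_mul_I_div_eq_zero hN
  have hc : ∑ i : Fin N, cos (2 * (π * i / N)) = 0 := by
    simpa only [Complex.re_sum, Complex.exp_ofReal_mul_I_re, Complex.zero_re] using
      congrArg Complex.re h
  have hs : ∑ i : Fin N, sin (2 * (π * i / N)) = 0 := by
    simpa only [Complex.im_sum, Complex.exp_ofReal_mul_I_im, Complex.zero_im] using
      congrArg Complex.im h
  calc ∑ i : Fin N, (cos (π * i / N) * a + sin (π * i / N) * b) ^ 2
      = ∑ i : Fin N, ((a ^ 2 + b ^ 2) / 2 + (a ^ 2 - b ^ 2) / 2 * cos (2 * (π * i / N)) +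
          a * b * sin (2 * (π * i / N))) := by
        refine Finset.sum_congr rfl fun i _ => ?_
        rw [cos_two_mul, sin_two_mul]
        linear_combination b ^ 2 * sin_sq_add_cos_sq (π * i / N)
    _ = N / 2 * (a ^ 2 + b ^ 2) := by
        rw [Finset.sum_add_distrib, Finset.sum_add_distrib, ← Finset.mul_sum, ← Finset.mul_sum,
          hc, hs, Finset.sum_const, Finset.card_univ, Fintype.card_fin, nsmul_eq_mul]
        ring

theorem abs_cos_pi_mul_div_sub_le {N : ℕ} {i j : Fin N} (hij : i ≠ j) :
    |cos (π * i / N - π * j / N)| ≤ cos (π / N) := by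
  wlog hlt : i < j generalizing i j
  · rw [← cos_neg, neg_sub]
    exact this hij.symm (lt_of_le_of_ne (not_lt.1 hlt) hij.symm)
  have hN : (0 : ℝ) < N := by exact_mod_cast i.pos
  have h1 : (i : ℝ) + 1 ≤ j := by exact_mod_cast hlt
  have h2 : (j : ℝ) + 1 ≤ N := by exact_mod_cast j.isLt
  have h0 : (0 : ℝ) ≤ i := by positivity
  rw [← cos_neg, neg_sub]
  have e : π * j / N - π * i / N = π / N * (j - i) := by ring
  have e' : π = π / N * N := by field_simp
  have hpos : 0 < π / N := by positivity
  have hlo : π / N ≤ π * j / N - π * i / N := by rw [e]; nlinarith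
  have hhi : π * j / N - π * i / N ≤ π - π / N := by rw [e]; nlinarith
  rw [abs_le, ← cos_pi_sub]
  constructor
  · exact cos_le_cos_of_nonneg_of_le_pi (by linarith) (by linarith) hhi
  · exact cos_le_cos_of_nonneg_of_le_pi (by linarith) (by linarith) hlo

variable {N a : ℕ}

/-- `N` vectors spanning equally spaced lines in the plane of the first two vectors of an
orthonormal basis, together with the other vectors of this basis. -/
def planarFrame (N : ℕ) (f : OrthonormalBasis (Fin 2 ⊕ Fin a) ℝ V) : Fin N ⊕ Fin a → V :=
  Sum.elim (fun i => cos (π * i / N) • f (.inl 0) + sin (π * i / N) • f (.inl 1))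
    fun j => f (.inr j)

theorem isSphericalFrame_planarFrame (f : OrthonormalBasis (Fin 2 ⊕ Fin a) ℝ V) (hN : 3 ≤ N) :
    IsSphericalFrame (planarFrame N f) (π / (N + a : ℕ)) := by
  have hN' : (3 : ℝ) ≤ N := by exact_mod_cast hN
  have ha : (0 : ℝ) ≤ a := by positivity
  have hle : π / (N + a : ℕ) ≤ π / N := by
    push_cast
    gcongr
    linarith
  have hle' : π / N ≤ π / 2 := by gcongr; linarith
  have hpos : 0 ≤ π / (N + a : ℕ) := by positivity
  have hcos : 0 ≤ cos (π / (N + a : ℕ)) :=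
    cos_nonneg_of_mem_Icc ⟨by linarith [pi_pos], by linarith⟩
  have hinl : ∀ (i : Fin N) (y : V), inner ℝ (planarFrame N f (.inl i)) y =
      cos (π * i / N) * inner ℝ (f (.inl 0)) y + sin (π * i / N) * inner ℝ (f (.inl 1)) y := by
    intro i y
    simp [planarFrame, inner_add_left, real_inner_smul_left]
  have hinr : ∀ j : Fin a, planarFrame N f (.inr j) = f (.inr j) := fun _ => rfl
  have hf : ∀ i j, inner ℝ (f i) (f j) = if i = j then (1 : ℝ) else 0 :=
    orthonormal_iff_ite.1 f.orthonormal
  have hself : ∀ i j : Fin N, inner ℝ (planarFrame N f (.inl i)) (planarFrame N f (.inl j)) =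
      cos (π * i / N - π * j / N) := by
    intro i j
    rw [hinl, real_inner_comm, hinl, real_inner_comm (planarFrame N f _), hinl, hf, hf, hf, hf,
      cos_sub]
    simp
  refine .of_abs_inner_le hpos (by linarith [pi_pos]) ?_ ?_ ?_
  · rintro (i | j)
    · rw [← pow_eq_one_iff_of_nonneg (norm_nonneg _) two_ne_zero,
        ← real_inner_self_eq_norm_sq, hself, sub_self, cos_zero]
    · exact f.norm_eq_one _
  · rintro (i | i) (j | j) hij
    · rw [hself]
      refine (abs_cos_pi_mul_div_sub_le fun h => hij (congrArg _ h)).trans ?_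
      exact cos_le_cos_of_nonneg_of_le_pi hpos (by linarith [pi_pos]) hle
    · simpa [hinl, hinr, hf] using hcos
    · rw [real_inner_comm]
      simpa [hinl, hinr, hf] using hcos
    · rw [hinr, hinr, f.inner_eq_zero fun h => hij (congrArg _ (Sum.inr_injective h)), abs_zero]
      exact hcos
  · intro y hy
    by_contra! h
    have hsq : ∀ i, inner ℝ (planarFrame N f i) y ^ 2 < sin (π / (N + a : ℕ) / 2) ^ 2 :=
      fun i => sq_lt_sq' (by linarith [(abs_lt.1 (h i)).1]) (abs_lt.1 (h i)).2
    have hm := mul_sin_pi_div_div_two_sq_le_one (m := N + a) (by omega)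
    set s := sin (π / (N + a : ℕ) / 2)
    have hplane : ∑ i : Fin N, inner ℝ (planarFrame N f (.inl i)) y ^ 2 < ∑ _i : Fin N, s ^ 2 :=
      Finset.sum_lt_sum_of_nonempty ⟨⟨0, by omega⟩, Finset.mem_univ _⟩ fun i _ => hsq _
    have hrest : ∑ j : Fin a, inner ℝ (f (.inr j)) y ^ 2 ≤ ∑ _j : Fin a, s ^ 2 :=
      Finset.sum_le_sum fun j _ => (hsq (.inr j)).le
    have hsum := f.sum_sq_inner_right y
    simp only [hinl] at hplane
    rw [sum_cos_mul_add_sin_mul_sq (by omega)] at hplane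
    rw [hy, Fintype.sum_sum_type, Fin.sum_univ_two] at hsum
    simp only [Finset.sum_const, Finset.card_univ, Fintype.card_fin, nsmul_eq_mul] at hplane hrest
    push_cast at hm
    nlinarith [sq_nonneg s]

end SphericalFrame

/-- For all 1 ≤ n < k < ∞, the Gromov–Hausdorff distance between the unit spheres
S^n ⊆ ℝ^{n+1} and S^k ⊆ ℝ^{k+1}, each with the Euclidean (chordal) metric, satisfies
d_GH(S^n_E, S^k_E) ≤ sin(πk/(2(k+1))). -/
theorem ghDist_euclidean_spheres_le (n k : ℕ) (hn : 1 ≤ n) (hnk : n < k) :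
    GromovHausdorff.ghDist
      (Metric.sphere (0 : Euc (n+1)) 1) (Metric.sphere (0 : Euc (k+1)) 1)
      ≤ Real.sin (π * k / (2 * ((k : ℝ) + 1))) := by
  obtain ⟨a, rfl⟩ : ∃ a, n = a + 1 := ⟨n - 1, by omega⟩
  obtain ⟨N, rfl⟩ : ∃ N, k = N + a - 1 := ⟨k + 1 - a, by omega⟩
  have hN : 3 ≤ N := by omega
  have hk : N + a - 1 + 1 = N + a := by omega
  let f : OrthonormalBasis (Fin 2 ⊕ Fin a) ℝ (Euc (a + 1 + 1)) :=
    (EuclideanSpace.basisFun _ ℝ).reindex (Fintype.equivOfCardEq (by simp; omega))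
  let g : OrthonormalBasis (Fin N ⊕ Fin a) ℝ (Euc (N + a - 1 + 1)) :=
    (EuclideanSpace.basisFun _ ℝ).reindex (Fintype.equivOfCardEq (by simp; omega))
  have hcard : Fintype.card (Fin N ⊕ Fin a) = N + a := by simp
  have hg := g.isSphericalFrame (by omega)
  rw [hcard] at hg
  have hm : (3 : ℝ) ≤ (N + a : ℕ) := by exact_mod_cast (by omega : 3 ≤ N + a)
  refine (ghDist_sphere_le_cos_of_isSphericalFrame (isSphericalFrame_planarFrame f hN) hg
    (by positivity) (by gcongr; linarith)).trans_eq ?_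
  have hk' : ((N + a - 1 : ℕ) : ℝ) = (N + a : ℕ) - 1 := by
    rw [eq_sub_iff_add_eq]
    exact_mod_cast hk
  rw [← sin_pi_div_two_sub, hk']
  congr 1
  have : ((N + a : ℕ) : ℝ) ≠ 0 := by linarith
  rw [sub_add_cancel]
  field_simp
end
end
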